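/- arXiv:1210.2679 — 2 statements merged into one kernel-verified Lean document; each statement's English description precedes it below -/
import Mathlib

section
/- Fix a prime p and w ≥ 0. Let N be the Pow(w)×Pow(w)-matrix with N_{λμ} = |𝓜_{λμ}|, and let z be the diagonal Pow(w)×Pow(w)-matrix with z_λ = Π_i i^{m_i(λ)} m_i(λ)!. Then N is row equivalent over ℤ_(p) to (N^T)^{-1} z, i.e., (N^T)^{-1} z = U N for some matrix U invertible over ℤ_(p). -/
open scoped BigOperators
open Classical

noncomputable section

/-- The number of maps `f` from the (indexed) parts of `mu` to the parts of `lam` such that for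
every part `lam_i` of `lam`, the sum of the parts of `mu` in the fibre `f⁻¹(i)` equals `lam_i`.
This is `|𝓜_{λμ}|` and also the value of the permutation character `h_λ` on the class of cycle
type `μ`. -/
def Mcount (lam mu : Multiset ℕ) : ℕ :=
  Fintype.card {f : Fin (Multiset.card mu) → Fin (Multiset.card lam) //
    ∀ i : Fin (Multiset.card lam),
      (∑ j ∈ Finset.univ.filter (fun j => f j = i), (mu.sort (· ≤ ·)).getD j 0)
        = (lam.sort (· ≤ ·)).getD i 0}

/-- `z_λ = ∏_i i^{m_i(λ)} m_i(λ)!`. -/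
def zMult (lam : Multiset ℕ) : ℕ :=
  ∏ i ∈ lam.toFinset, i ^ lam.count i * (lam.count i).factorial

/-- The cycle type of a permutation of `Fin n`, as the multiset of parts of a partition of `n`
(including the parts equal to `1` corresponding to fixed points). -/
def cycM {n : ℕ} (g : Equiv.Perm (Fin n)) : Multiset ℕ :=
  g.cycleType + Multiset.replicate (n - g.support.card) 1

/-- The value of the irreducible character `s_λ` of the symmetric group on the conjugacy class
of cycle type `nu`, given by the Jacobi–Trudi determinant `s_λ = det(h_{λ_i - i + j})_{i,j}`,
where `h_α` has value `Mcount α ν` on the class of cycle type `ν`. -/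
def sval (lam nu : Multiset ℕ) : ℚ :=
  let L := (lam.sort (· ≤ ·)).reverse
  let l := Multiset.card lam
  ∑ σ : Equiv.Perm (Fin l),
    ((Equiv.Perm.sign σ : ℤ) : ℚ) *
      (if ∀ i : Fin l, (i : ℕ) ≤ L.getD i 0 + (σ i : ℕ) then
        (Mcount ((Multiset.map (fun i : Fin l => L.getD i 0 + (σ i : ℕ) - (i : ℕ))
            (Finset.univ.val : Multiset (Fin l))).filter (fun x => x ≠ 0)) nu : ℚ)
       else 0)

/-- The irreducible character of `S_n` labelled by the partition `lam`, as a class function on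
the symmetric group `S_n = Perm (Fin n)`. -/
def sFun {n : ℕ} (lam : Nat.Partition n) : Equiv.Perm (Fin n) → ℚ :=
  fun g => sval lam.parts (cycM g)

/-- The usual scalar product of class functions on a finite group:
`⟨f, h⟩ = |G|⁻¹ ∑_{g ∈ G} f(g) h(g⁻¹)`. -/
def sp {G : Type*} [Group G] [Fintype G] (f h : G → ℚ) : ℚ :=
  (Fintype.card G : ℚ)⁻¹ * ∑ g : G, f g * h g⁻¹

/-- The subring `ℤ_(p) = {a/b ∈ ℚ : p ∤ b} ⊆ ℚ`. -/
def Zploc (p : ℕ) (hp : p.Prime) : Subring ℚ where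
  carrier := {x : ℚ | ∃ a b : ℤ, ¬ (p : ℤ) ∣ b ∧ x = a / b}
  zero_mem' :=
    ⟨0, 1, fun h => by have h1 := Int.le_of_dvd one_pos h; have h2 := hp.two_le; omega, by simp⟩
  one_mem' :=
    ⟨1, 1, fun h => by have h1 := Int.le_of_dvd one_pos h; have h2 := hp.two_le; omega, by simp⟩
  add_mem' := by
    rintro x y ⟨a, b, hb, rfl⟩ ⟨c, d, hd, rfl⟩
    have hb0 : (b : ℚ) ≠ 0 := by
      intro h
      apply hb
      have hb' : b = 0 := by exact_mod_cast h
      simp [hb']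
    have hd0 : (d : ℚ) ≠ 0 := by
      intro h
      apply hd
      have hd' : d = 0 := by exact_mod_cast h
      simp [hd']
    refine ⟨a * d + c * b, b * d, ?_, ?_⟩
    · intro h
      rcases (Nat.prime_iff_prime_int.mp hp).dvd_mul.mp h with h' | h'
      · exact hb h'
      · exact hd h'
    · push_cast
      field_simp
  neg_mem' := by
    rintro x ⟨a, b, hb, rfl⟩
    exact ⟨-a, b, hb, by push_cast; ring⟩
  mul_mem' := by
    rintro x y ⟨a, b, hb, rfl⟩ ⟨c, d, hd, rfl⟩
    refine ⟨a * c, b * d, ?_, ?_⟩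
    · intro h
      rcases (Nat.prime_iff_prime_int.mp hp).dvd_mul.mp h with h' | h'
      · exact hb h'
      · exact hd h'
    · push_cast
      ring

/-- `Pow(w)`: the partitions of `w` all of whose parts are powers of `p` (including `p^0 = 1`). -/
abbrev PowP (p w : ℕ) : Type := {lam : Nat.Partition w // ∀ j ∈ lam.parts, ∃ n : ℕ, j = p ^ n}

/-- The matrix `N = N^{(w)}` on `Pow(w)`: `N_{λμ} = |𝓜_{λμ}|`. -/
def Nmat (p w : ℕ) : Matrix (PowP p w) (PowP p w) ℚ :=
  Matrix.of fun lam mu => (Mcount lam.1.parts mu.1.parts : ℚ)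

namespace RE
open PowerSeries

lemma ode_zero {F : Type*} [Field F] [CharZero F] (K D : F⟦X⟧) (hK : constantCoeff K = 0)
    (hD0 : constantCoeff D = 0) (hD : X * d⁄dX F D = K * D) : D = 0 := by
  have : ∀ n, ∀ m ≤ n, coeff m D = 0 := by
    intro n
    induction n with
    | zero => intro m hm; obtain rfl : m = 0 := by omega
              simpa using hD0
    | succ n ih =>
      intro m hm
      rcases Nat.lt_or_ge m (n+1) with h | h
      · exact ih m (by omega)
      obtain rfl : m = n+1 := by omega
      have h1 := congrArg (coeff (n+1)) hD
      rw [coeff_succ_X_mul, coeff_derivative, coeff_mul] at h1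
      rw [Finset.sum_eq_zero] at h1
      · have : ((n:F)+1) ≠ 0 := by exact_mod_cast Nat.succ_ne_zero n
        simpa [this] using h1
      · rintro ⟨i, j⟩ hij
        have hij : i + j = n + 1 := Finset.HasAntidiagonal.mem_antidiagonal.1 hij
        rcases Nat.eq_zero_or_pos i with h0 | h0
        · subst h0; simp [hK]
        · change _ * coeff j D = 0
          rw [ih j (by omega), mul_zero]
  ext n; simpa using this n n le_rfl

def Hser (p : ℕ) (F : Type*) [Field F] : F⟦X⟧ := PowerSeries.mk fun n => if ∃ k, n = p ^ k then 1 else 0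

lemma Hser_eq {p : ℕ} (hp : p.Prime) (F : Type*) [Field F] :
    Hser p F = X + expand p hp.ne_zero (Hser p F) := by
  ext n
  rw [map_add, coeff_expand, coeff_X, Hser, coeff_mk, coeff_mk]
  have h2 := hp.two_le
  by_cases h1 : n = 1
  · subst h1
    rw [if_pos ⟨0, by simp⟩, if_pos rfl, if_neg (by simpa using hp.one_lt.ne'), add_zero]
  · rw [if_neg h1, zero_add]
    by_cases hd : p ∣ n
    · rw [if_pos hd]
      obtain ⟨m, rfl⟩ := hd
      rw [Nat.mul_div_cancel_left _ hp.pos]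
      congr 1
      apply propext
      constructor
      · rintro ⟨k, hk⟩
        cases k with
        | zero => simp at hk; omega
        | succ k => rw [pow_succ'] at hk; exact ⟨k, Nat.eq_of_mul_eq_mul_left hp.pos hk⟩
      · rintro ⟨k, hk⟩; exact ⟨k+1, by rw [pow_succ', hk]⟩
    · rw [if_neg hd, if_neg]
      rintro ⟨k, hk⟩
      cases k with
      | zero => simp at hk; omega
      | succ k => exact hd ⟨p^k, by rw [hk, pow_succ']⟩

lemma derivative_expand {p : ℕ} (hp : p.Prime) {F : Type*} [Field F] (E : F⟦X⟧) :
    X * d⁄dX F (expand p hp.ne_zero E) = (p : F⟦X⟧) * expand p hp.ne_zero (X * d⁄dX F E) := by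
  rw [expand_apply, derivative_subst (HasSubst.X_pow hp.ne_zero), map_mul, expand_X, expand_apply, derivative_pow]
  simp only [derivative_X]
  have : (X : F⟦X⟧)^p = X * X^(p-1) := by rw [← pow_succ', Nat.sub_add_cancel hp.one_le]
  rw [this]; ring

lemma AH_pow {p : ℕ} (hp : p.Prime) {F : Type*} [Field F] [CharZero F] [Algebra ℚ F] (E : F⟦X⟧)
    (h0 : constantCoeff E = 1) (hE : X * d⁄dX F E = Hser p F * E) :
    E ^ p = expand p hp.ne_zero E * (exp F) ^ p := by
  rw [← sub_eq_zero]
  apply ode_zero ((p : F⟦X⟧) * Hser p F)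
  · have : constantCoeff (Hser p F) = 0 := by
      rw [← coeff_zero_eq_constantCoeff_apply, Hser, coeff_mk, if_neg]
      rintro ⟨x, hx⟩; exact absurd hx.symm (pow_ne_zero _ hp.ne_zero)
    rw [map_mul, this, mul_zero]
  · simp [h0]
  · have h1 : X * d⁄dX F (E^p) = (p : F⟦X⟧) * Hser p F * E^p := by
      rw [derivative_pow]
      have : E^p = E^(p-1) * E := by rw [← pow_succ, Nat.sub_add_cancel hp.one_le]
      rw [this]
      linear_combination (p : F⟦X⟧) * E^(p-1) * hE
    have h2 : X * d⁄dX F ((exp F)^p) = (p : F⟦X⟧) * X * (exp F)^p := by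
      rw [derivative_pow, derivative_exp]
      have : (exp F)^p = (exp F)^(p-1) * exp F := by rw [← pow_succ, Nat.sub_add_cancel hp.one_le]
      rw [this]; ring
    have h3 := derivative_expand hp E
    rw [hE, map_mul] at h3
    rw [map_sub, Derivation.leibniz]
    simp only [smul_eq_mul]
    have h4 := Hser_eq hp F
    linear_combination h1 - (expand p hp.ne_zero E) * h2 - (exp F)^p * h3 + (p : F⟦X⟧) * (expand p hp.ne_zero E) * (exp F)^p * h4

lemma norm_p_pow_div_factorial (p : ℕ) [hp : Fact p.Prime] (j : ℕ) (hj : j ≠ 0) :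
    ‖((p : ℚ_[p])^j / (j.factorial : ℚ_[p]))‖ ≤ (p:ℝ)⁻¹ := by
  have hlt := padicValNat_factorial_lt_of_ne_zero p hj
  obtain ⟨u, hu⟩ : p ^ (padicValNat p j.factorial) ∣ j.factorial := pow_padicValNat_dvd
  set v := padicValNat p j.factorial with hv
  have hpu : ¬ p ∣ u := by
    intro ⟨c, hc⟩
    have : p ^ (v+1) ∣ j.factorial := ⟨c, by rw [hu, hc]; ring⟩
    exact pow_succ_padicValNat_not_dvd (Nat.factorial_ne_zero j) this
  have hun : ‖(u : ℚ_[p])‖ = 1 := by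
    rw [Padic.norm_natCast_eq_one_iff]
    exact (Nat.Prime.coprime_iff_not_dvd hp.out).2 hpu
  rw [hu]
  push_cast
  rw [norm_div, norm_mul, norm_pow, norm_pow, hun, Padic.norm_p, mul_one]
  have hp0 : (0:ℝ) < p := by exact_mod_cast hp.out.pos
  rw [div_le_iff₀ (by positivity), ← pow_succ']
  apply pow_le_pow_of_le_one (by positivity) _ (by omega)
  apply inv_le_one_of_one_le₀
  exact_mod_cast hp.out.one_le

lemma frob_small (p : ℕ) [hp : Fact p.Prime] (f : Polynomial ℤ_[p]) (n : ℕ) :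
    ‖((f ^ p - Polynomial.expand ℤ_[p] p f).coeff n)‖ ≤ (p:ℝ)⁻¹ := by
  have h : (f ^ p - Polynomial.expand ℤ_[p] p f).map (PadicInt.toZMod (p := p)) = 0 := by
    rw [Polynomial.map_sub, Polynomial.map_pow, Polynomial.map_expand, ZMod.expand_card, sub_self]
  have h1 := congrArg (fun g => Polynomial.coeff g n) h
  simp only [Polynomial.coeff_map, Polynomial.coeff_zero] at h1
  rw [← RingHom.mem_ker, PadicInt.ker_toZMod, PadicInt.maximalIdeal_eq_span_p] at h1
  have := (PadicInt.norm_le_pow_iff_mem_span_pow ((f ^ p - Polynomial.expand ℤ_[p] p f).coeff n) 1).2 (by simpa using h1)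
  simpa using this

lemma AH_integral (p : ℕ) [hp : Fact p.Prime] (E : ℚ_[p]⟦X⟧)
    (h0 : constantCoeff E = 1) (hE : X * d⁄dX ℚ_[p] E = Hser p ℚ_[p] * E) (n : ℕ) :
    ‖coeff n E‖ ≤ 1 := by
  have hpow := AH_pow hp.out E h0 hE
  induction n using Nat.strong_induction_on with
  | _ n ih =>
  rcases Nat.eq_zero_or_pos n with hn | hn
  · subst hn; simp [h0]
  have hg : ∀ i, ∃ g : ℤ_[p], (g : ℚ_[p]) = if i < n then coeff i E else 0 := by
    intro i
    split_ifs with h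
    · exact ⟨⟨coeff i E, ih i h⟩, rfl⟩
    · exact ⟨0, rfl⟩
  choose g hg using hg
  let f : Polynomial ℤ_[p] := ∑ i ∈ Finset.range n, Polynomial.monomial i (g i)
  have hfc : ∀ i, ((f.coeff i : ℤ_[p]) : ℚ_[p]) = if i < n then coeff i E else 0 := by
    intro i
    simp only [f, Polynomial.finsetSum_coeff, Polynomial.coeff_monomial]
    rw [Finset.sum_ite_eq']
    by_cases h : i < n
    · rw [if_pos (Finset.mem_range.2 h), hg]
    · rw [if_neg (fun h' => h (Finset.mem_range.1 h')), if_neg h]; simp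
  let Fp : Polynomial ℚ_[p] := f.map (PadicInt.Coe.ringHom (p := p))
  have hFc : ∀ i, Fp.coeff i = if i < n then coeff i E else 0 := by
    intro i; rw [← hfc i, Polynomial.coeff_map]; rfl
  let F : ℚ_[p]⟦X⟧ := Fp
  have hF : ∀ i, coeff i F = if i < n then coeff i E else 0 := by
    intro i; rw [Polynomial.coeff_coe, hFc]
  let R : ℚ_[p]⟦X⟧ := PowerSeries.mk fun i => coeff (i + n) E
  have hER : E = F + X^n * R := by
    ext i
    rw [map_add, hF, coeff_X_pow_mul']
    by_cases h : i < n
    · rw [if_pos h, if_neg (by omega), add_zero]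
    · rw [if_neg h, if_pos (by omega), zero_add, coeff_mk, Nat.sub_add_cancel (by omega)]
  obtain ⟨k, hk⟩ := Polynomial.powAddExpansion F (X^n * R) p
  rw [← hER] at hk
  have hF0 : constantCoeff F = 1 := by
    have := hF 0
    rw [if_pos hn] at this
    simpa [h0] using this
  have hc1 : coeff n (E ^ p) = coeff n (F^p) + p * coeff n E := by
    rw [hk, map_add, map_add]
    have e1 : (p : ℚ_[p]⟦X⟧) * F^(p-1) * (X^n * R) = X^n * ((p : ℚ_[p]⟦X⟧) * F^(p-1) * R) := by ring
    have e2 : k * (X^n*R)^2 = X^(2*n) * (k * R^2) := by ring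
    rw [e1, e2, coeff_X_pow_mul', coeff_X_pow_mul', if_pos le_rfl, if_neg (by omega), Nat.sub_self, add_zero]
    simp [hF0, R]
  have hFp : coeff n (F^p) = (((f^p).coeff n : ℤ_[p]) : ℚ_[p]) := by
    have : F^p = ((Fp^p : Polynomial ℚ_[p]) : ℚ_[p]⟦X⟧) := by simp [F]
    rw [this, Polynomial.coeff_coe, ← Polynomial.map_pow, Polynomial.coeff_map]; rfl
  have hexpn : coeff n (expand p hp.out.ne_zero E) = (((Polynomial.expand ℤ_[p] p f).coeff n : ℤ_[p]) : ℚ_[p]) := by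
    rw [coeff_expand, Polynomial.coeff_expand hp.out.pos]
    split_ifs with h
    · rw [hfc, if_pos (Nat.div_lt_self hn hp.out.one_lt)]
    · simp
  have hp0 : (0:ℝ) < p := by exact_mod_cast hp.out.pos
  have hc2 : ‖coeff n (expand p hp.out.ne_zero E * (exp ℚ_[p])^p) - coeff n (expand p hp.out.ne_zero E)‖ ≤ (p:ℝ)⁻¹ := by
    rw [coeff_mul, ← Finset.add_sum_erase _ _ (a := (n,0)) (by simp)]
    simp only [coeff_zero_eq_constantCoeff, map_pow, constantCoeff_exp, one_pow, mul_one, add_sub_cancel_left]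
    apply IsUltrametricDist.norm_sum_le_of_forall_le_of_nonneg (by positivity)
    rintro ⟨i, j⟩ hij
    rw [Finset.mem_erase, Finset.HasAntidiagonal.mem_antidiagonal] at hij
    have hij2 : i + j = n := hij.2
    simp only [ne_eq, Prod.mk.injEq, not_and] at hij
    have hj : j ≠ 0 := by intro hj; exact hij.1 (by omega) hj
    simp only
    rw [exp_pow_eq_rescale_exp, norm_mul, coeff_rescale, coeff_exp]
    have hb : ‖((p : ℚ_[p])^j * (algebraMap ℚ ℚ_[p]) (1 / (j.factorial:ℚ)))‖ ≤ (p:ℝ)⁻¹ := by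
      have := norm_p_pow_div_factorial p j hj
      convert this using 2
      simp [div_eq_mul_inv]
    have ha : ‖coeff i (expand p hp.out.ne_zero E)‖ ≤ 1 := by
      rw [coeff_expand]
      split_ifs
      · exact ih _ (lt_of_le_of_lt (Nat.div_le_self _ _) (by omega))
      · simp
    calc _ ≤ 1 * (p:ℝ)⁻¹ := mul_le_mul ha hb (norm_nonneg _) zero_le_one
      _ = _ := one_mul _
  have hfs := frob_small p f n
  rw [← hpow, hc1, hFp, hexpn] at hc2
  rw [PadicInt.norm_def, Polynomial.coeff_sub] at hfs
  have : ‖(p : ℚ_[p]) * coeff n E‖ ≤ (p:ℝ)⁻¹ := by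
    have e : (p : ℚ_[p]) * coeff n E = (((f^p).coeff n : ℤ_[p]) + p * coeff n E - ((Polynomial.expand ℤ_[p] p f).coeff n : ℤ_[p]))
      - ((((f^p).coeff n - (Polynomial.expand ℤ_[p] p f).coeff n : ℤ_[p])) : ℚ_[p]) := by
      push_cast; ring
    rw [e]
    rw [sub_eq_add_neg _ (((_ : ℤ_[p])) : ℚ_[p])]
    exact (IsUltrametricDist.norm_add_le_max _ _).trans (max_le hc2 (by rw [norm_neg]; exact hfs))
  rw [norm_mul, Padic.norm_p] at this
  have h3 : (0:ℝ) < (p:ℝ)⁻¹ := by positivity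
  nlinarith
end RE

namespace RE
open PowerSeries

lemma mem_Zploc_of_norm {p : ℕ} (hp : p.Prime) [Fact p.Prime] (x : ℚ) (hx : ‖(x : ℚ_[p])‖ ≤ 1) :
    x ∈ Zploc p hp := by
  refine ⟨x.num, x.den, ?_, by simp [Rat.num_div_den]⟩
  intro h
  have hd : ‖((x.den : ℤ) : ℚ_[p])‖ < 1 := Padic.norm_intCast_lt_one_iff.2 h
  have hn : ¬ (p : ℤ) ∣ x.num := by
    intro h'
    have h1 : p ∣ x.num.natAbs := by exact Int.natCast_dvd.1 h'
    have h2 : p ∣ x.den := by exact_mod_cast h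
    have := Nat.dvd_gcd h1 h2
    rw [x.reduced] at this
    exact hp.one_lt.ne' (Nat.dvd_one.1 this)
  have hn1 : ‖(x.num : ℚ_[p])‖ = 1 := by
    apply le_antisymm (Padic.norm_int_le_one _)
    by_contra hlt
    exact hn (Padic.norm_intCast_lt_one_iff.1 (not_le.1 hlt))
  have hxe : (x.num : ℚ_[p]) = (x : ℚ_[p]) * ((x.den : ℤ) : ℚ_[p]) := by
    have : (x.num : ℚ) = x * (x.den : ℤ) := by simp [Rat.mul_den_eq_num]
    exact_mod_cast congrArg (fun y : ℚ => (y : ℚ_[p])) this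
  rw [hxe, norm_mul] at hn1
  nlinarith [norm_nonneg (x : ℚ_[p]), norm_nonneg ((x.den : ℤ) : ℚ_[p])]

def isP (p q : ℕ) : Prop := ∃ k, q = p ^ k

def eseq (p : ℕ) : ℕ → ℚ
  | 0 => 1
  | n+1 => (1 / ((n:ℚ)+1)) * ∑ i : Fin (n+1), if isP p (n + 1 - i.1) then eseq p i.1 else 0

lemma eseq_zero (p : ℕ) : eseq p 0 = 1 := by rw [eseq]

lemma not_isP_zero {p : ℕ} (hp : p.Prime) : ¬ isP p 0 := by
  rintro ⟨k, hk⟩; exact absurd hk.symm (pow_ne_zero _ hp.ne_zero)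

lemma eseq_rec {p : ℕ} (hp : p.Prime) (n : ℕ) :
    (n : ℚ) * eseq p n = ∑ q ∈ Finset.range (n+1), if isP p q then eseq p (n - q) else 0 := by
  cases n with
  | zero => simp [not_isP_zero hp]
  | succ n =>
    rw [eseq, ← mul_assoc]
    have : ((n+1 : ℕ) : ℚ) * (1 / ((n:ℚ)+1)) = 1 := by
      push_cast; field_simp
    rw [this, one_mul]
    rw [← Finset.sum_range_reflect, Finset.sum_range_succ]
    rw [Fin.sum_univ_eq_sum_range (fun i => if isP p (n + 1 - i) then eseq p i else 0)]
    rw [if_neg, add_zero]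
    · apply Finset.sum_congr rfl
      intro i hi
      have hi := Finset.mem_range.1 hi
      have e1 : n + 1 + 1 - 1 - i = n + 1 - i := by omega
      have e2 : n + 1 - (n + 1 - i) = i := by omega
      rw [e1, e2]
    · have : n + 1 + 1 - 1 - (n+1) = 0 := by omega
      rw [this]; exact not_isP_zero hp

lemma eseq_mem {p : ℕ} (hp : p.Prime) (n : ℕ) : eseq p n ∈ Zploc p hp := by
  haveI : Fact p.Prime := ⟨hp⟩
  apply mem_Zploc_of_norm hp
  let E : ℚ_[p]⟦X⟧ := PowerSeries.mk fun n => ((eseq p n : ℚ) : ℚ_[p])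
  have := AH_integral p E (by simp [E, ← coeff_zero_eq_constantCoeff_apply, -coeff_zero_eq_constantCoeff, eseq_zero]) ?_ n
  · simpa [E] using this
  · ext n
    have h := eseq_rec hp n
    have hc : coeff n (X * d⁄dX ℚ_[p] E) = (((n:ℚ) * eseq p n : ℚ) : ℚ_[p]) := by
      cases n with
      | zero => simp
      | succ n => rw [coeff_succ_X_mul, coeff_derivative, coeff_mk]; push_cast; ring
    rw [hc, h, coeff_mul, Finset.Nat.sum_antidiagonal_eq_sum_range_succ_mk]
    push_cast
    apply Finset.sum_congr rfl
    intro q _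
    simp only [Hser, E, coeff_mk]
    by_cases hq : isP p q
    · rw [if_pos hq, if_pos (show ∃ k, q = p^k from hq), one_mul]
    · rw [if_neg hq, if_neg (show ¬ ∃ k, q = p^k from hq)]; simp
end RE

namespace RE
open MvPolynomial

def mkP {p w : ℕ} (hp : p.Prime) (m : Multiset ℕ) (h : ∀ j ∈ m, isP p j) (hs : m.sum = w) : PowP p w :=
  ⟨⟨m, fun {i} hi => by
    rcases Nat.eq_zero_or_pos i with h0 | h0
    · subst h0; exact absurd (h 0 hi) (not_isP_zero hp)
    · exact h0, hs⟩, h⟩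

lemma PowP_ext {p w : ℕ} {a b : PowP p w} (h : a.1.parts = b.1.parts) : a = b :=
  Subtype.ext (Nat.Partition.ext h)

lemma reindex {p : ℕ} (hp : p.Prime) (w : ℕ) {M : Type*} [AddCommMonoid M] (F : ℕ → Multiset ℕ → M) :
    ∑ μ : PowP p w, ∑ q ∈ μ.1.parts.toFinset, F q (μ.1.parts.erase q) =
    ∑ q ∈ Finset.range (w+1), if isP p q then ∑ ν : PowP p (w-q), F q ν.1.parts else 0 := by
  rw [Finset.sum_comm' (t' := Finset.range (w+1)) (s' := fun q => Finset.univ.filter (fun μ : PowP p w => q ∈ μ.1.parts))]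
  · apply Finset.sum_congr rfl
    intro q hq
    have hq : q < w + 1 := Finset.mem_range.1 hq
    split_ifs with h
    · refine Finset.sum_bij' (fun μ hμ => mkP hp (μ.1.parts.erase q) (fun j hj => μ.2 j (Multiset.mem_of_mem_erase hj)) ?_)
        (fun ν _ => mkP hp (q ::ₘ ν.1.parts) ?_ ?_) ?_ ?_ ?_ ?_ ?_
      · have h1 : q ∈ μ.1.parts := (Finset.mem_filter.1 hμ).2
        have := Multiset.sum_erase h1
        rw [μ.1.parts_sum] at this
        omega
      · intro j hj
        rcases Multiset.mem_cons.1 hj with rfl | hj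
        · exact h
        · exact ν.2 j hj
      · rw [Multiset.sum_cons, ν.1.parts_sum]; omega
      · intros; exact Finset.mem_univ _
      · intros; exact Finset.mem_filter.2 ⟨Finset.mem_univ _, Multiset.mem_cons_self _ _⟩
      · intro μ hμ
        exact PowP_ext (Multiset.cons_erase (Finset.mem_filter.1 hμ).2)
      · intro ν _
        exact PowP_ext (Multiset.erase_cons_head _ _)
      · intros; rfl
    · apply Finset.sum_eq_zero
      intro μ hμ
      exact absurd (μ.2 q (Finset.mem_filter.1 hμ).2) h
  · intro μ q
    simp only [Finset.mem_univ, true_and, Multiset.mem_toFinset, Finset.mem_filter, Finset.mem_range]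
    constructor
    · intro h; exact ⟨h, Nat.lt_succ_of_le (Nat.Partition.le_of_mem_parts h)⟩
    · exact fun h => h.1

lemma zMult_superset (m : Multiset ℕ) (S : Finset ℕ) (h : m.toFinset ⊆ S) :
    zMult m = ∏ i ∈ S, i ^ m.count i * (m.count i).factorial := by
  rw [zMult]
  apply Finset.prod_subset h
  intro i _ hi
  rw [Multiset.mem_toFinset] at hi
  simp [Multiset.count_eq_zero_of_notMem hi]

lemma zMult_erase {m : Multiset ℕ} {q : ℕ} (hq : q ∈ m) :
    zMult m = q * m.count q * zMult (m.erase q) := by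
  have hqm : q ∈ m.toFinset := Multiset.mem_toFinset.2 hq
  rw [zMult, zMult_superset (m.erase q) m.toFinset, ← Finset.mul_prod_erase _ _ hqm,
    ← Finset.mul_prod_erase _ _ hqm, ← mul_assoc]
  · congr 1
    · rw [Multiset.count_erase_self]
      have : 0 < m.count q := Multiset.count_pos.2 hq
      obtain ⟨c, hc⟩ : ∃ c, m.count q = c + 1 := ⟨m.count q - 1, by omega⟩
      rw [hc, Nat.factorial_succ]
      simp only [Nat.add_sub_cancel]
      ring
    · apply Finset.prod_congr rfl
      intro i hi
      rw [Multiset.count_erase_of_ne (Finset.ne_of_mem_erase hi)]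
  · intro i hi
    rw [Multiset.mem_toFinset] at hi ⊢
    exact Multiset.mem_of_mem_erase hi

lemma zMult_pos {p w : ℕ} (μ : PowP p w) : 0 < zMult μ.1.parts := by
  apply Finset.prod_pos
  intro i hi
  have := μ.1.parts_pos (Multiset.mem_toFinset.1 hi)
  positivity

def PP (σ : Type*) [Fintype σ] (m : Multiset ℕ) : MvPolynomial σ ℚ := (m.map (psum σ ℚ)).prod

lemma D_psum {σ : Type*} [Fintype σ] (c : σ) (q : ℕ) :
    X c * pderiv c (psum σ ℚ q) = (q : MvPolynomial σ ℚ) * X c ^ q := by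
  rw [psum, map_sum, Finset.sum_eq_single c]
  · rw [pderiv_pow, pderiv_X_self, mul_one]
    cases q with
    | zero => simp
    | succ q => simp; ring
  · intro b _ hb
    rw [pderiv_pow, pderiv_X_of_ne hb, mul_zero]
  · simp

lemma D_PP {σ : Type*} [Fintype σ] (c : σ) (m : Multiset ℕ) :
    X c * pderiv c (PP σ m) = (m.map fun q : ℕ => (q : MvPolynomial σ ℚ) * X c ^ q * PP σ (m.erase q)).sum := by
  induction m using Multiset.induction_on with
  | empty => simp [PP]
  | cons a m ih =>
    have h1 : PP σ (a ::ₘ m) = psum σ ℚ a * PP σ m := by simp [PP]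
    rw [h1, Derivation.leibniz, smul_eq_mul, smul_eq_mul, mul_add, Multiset.map_cons, Multiset.sum_cons,
      Multiset.erase_cons_head]
    have h2 : m.map (fun q : ℕ => (q : MvPolynomial σ ℚ) * X c ^ q * PP σ ((a ::ₘ m).erase q))
      = m.map (fun q : ℕ => psum σ ℚ a * ((q : MvPolynomial σ ℚ) * X c ^ q * PP σ (m.erase q))) := by
      apply Multiset.map_congr rfl
      intro q hq
      rw [Multiset.erase_cons_tail_of_mem hq]
      simp only [PP, Multiset.map_cons, Multiset.prod_cons]; ring
    rw [h2, Multiset.sum_map_mul_left, ← ih]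
    linear_combination PP σ m * D_psum c a

def GG (p : ℕ) (σ : Type*) [Fintype σ] (w : ℕ) : MvPolynomial σ ℚ :=
  ∑ μ : PowP p w, C (1 / (zMult μ.1.parts : ℚ)) * PP σ μ.1.parts

lemma D_GG {p : ℕ} (hp : p.Prime) {σ : Type*} [Fintype σ] (c : σ) (w : ℕ) :
    X c * pderiv c (GG p σ w) = ∑ q ∈ Finset.range (w+1), if isP p q then X c ^ q * GG p σ (w - q) else 0 := by
  have := reindex hp w (fun q m => X c ^ q * (C (1 / (zMult m : ℚ)) * PP σ m))
  simp only [← Finset.mul_sum] at this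
  unfold GG
  rw [← this, map_sum, Finset.mul_sum]
  apply Finset.sum_congr rfl
  intro μ _
  rw [pderiv_C_mul, mul_left_comm, D_PP, Finset.sum_multiset_map_count, Finset.mul_sum]
  apply Finset.sum_congr rfl
  intro q hq
  rw [Multiset.mem_toFinset] at hq
  have hz := zMult_erase hq
  have hpos := zMult_pos μ
  have hC : C (1 / (zMult μ.1.parts : ℚ)) * ((μ.1.parts.count q : MvPolynomial σ ℚ) * (q : MvPolynomial σ ℚ)) = C (1 / (zMult (μ.1.parts.erase q) : ℚ)) := by
    have e : ((μ.1.parts.count q : MvPolynomial σ ℚ) * (q : MvPolynomial σ ℚ)) = C ((μ.1.parts.count q : ℚ) * q) := by simp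
    rw [e, ← C_mul]
    congr 1
    have h0 : (zMult μ.1.parts : ℚ) ≠ 0 := by exact_mod_cast hpos.ne'
    rw [hz] at h0 ⊢
    push_cast at h0 ⊢
    have := right_ne_zero_of_mul h0
    have h3 := left_ne_zero_of_mul h0
    have h4 := left_ne_zero_of_mul h3
    have h5 := right_ne_zero_of_mul h3
    field_simp
  rw [← hC, nsmul_eq_mul]
  ring

lemma coeff_D {σ : Type*} [Fintype σ] (c : σ) (f : MvPolynomial σ ℚ) (A : σ →₀ ℕ) :
    coeff A (X c * pderiv c f) = (A c : ℚ) * coeff A f := by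
  rw [coeff_X_mul']
  split_ifs with h
  · rw [coeff_pderiv]
    have hc : 1 ≤ A c := Nat.one_le_iff_ne_zero.2 (Finsupp.mem_support_iff.1 h)
    rw [tsub_add_cancel_of_le (by rw [Finsupp.single_le_iff]; exact hc)]
    simp only [Finsupp.coe_tsub, Pi.sub_apply, Finsupp.single_eq_same]
    rw [Nat.cast_sub hc]; push_cast; ring
  · rw [Finsupp.notMem_support_iff] at h
    simp [h]

lemma coeff_rec {p : ℕ} (hp : p.Prime) {σ : Type*} [Fintype σ] (c : σ) (w : ℕ) (A : σ →₀ ℕ) :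
    (A c : ℚ) * coeff A (GG p σ w) = ∑ q ∈ Finset.range (w+1),
      if isP p q then (if q ≤ A c then coeff (A - Finsupp.single c q) (GG p σ (w - q)) else 0) else 0 := by
  rw [← coeff_D, D_GG hp, coeff_sum]
  apply Finset.sum_congr rfl
  intro q _
  split_ifs with h1 h2
  · rw [X_pow_eq_monomial, coeff_monomial_mul', if_pos (by rwa [Finsupp.single_le_iff]), one_mul]
  · rw [X_pow_eq_monomial, coeff_monomial_mul', if_neg (by rwa [Finsupp.single_le_iff])]
  · simp

lemma coeff_zero_GG {p : ℕ} (σ : Type*) [Fintype σ] (w : ℕ) :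
    coeff 0 (GG p σ w) = if w = 0 then 1 else 0 := by
  have h : ∀ m : Multiset ℕ, (∀ i ∈ m, 0 < i) → coeff 0 (PP σ m) = if m = 0 then 1 else 0 := by
    intro m hm
    rw [← constantCoeff_eq, PP, map_multiset_prod, Multiset.map_map]
    split_ifs with h
    · subst h; simp
    · obtain ⟨a, ha⟩ := Multiset.exists_mem_of_ne_zero h
      apply Multiset.prod_eq_zero
      rw [Multiset.mem_map]
      refine ⟨a, ha, ?_⟩
      have := (hm a ha).ne'
      simp [psum, this]
  rw [GG, coeff_sum]
  simp only [coeff_C_mul]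
  split_ifs with hw
  · subst hw
    have : ∀ μ : PowP p 0, μ.1.parts = 0 := by
      intro μ
      by_contra hne
      obtain ⟨a, ha⟩ := Multiset.exists_mem_of_ne_zero hne
      have h1 := μ.1.parts_pos ha
      have h2 := Nat.Partition.le_of_mem_parts ha
      omega
    rw [Finset.sum_eq_single (⟨⟨0, by simp, by simp⟩, by simp⟩ : PowP p 0)]
    · simp [PP, zMult]
    · intro b _ hb; exact absurd (PowP_ext (by rw [this b])) hb
    · simp
  · apply Finset.sum_eq_zero
    intro μ _
    rw [h _ (fun i hi => μ.1.parts_pos hi), if_neg, mul_zero]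
    intro h0
    apply hw
    rw [← μ.1.parts_sum, h0]; simp

lemma coeff_GG {p : ℕ} (hp : p.Prime) (σ : Type*) [Fintype σ] : ∀ (n : ℕ) (A : σ →₀ ℕ) (w : ℕ), (∑ c, A c) = n →
    coeff A (GG p σ w) = if n = w then ∏ c, eseq p (A c) else 0 := by
  intro n
  induction n using Nat.strong_induction_on with
  | _ n ih =>
  intro A w hA
  rcases Nat.eq_zero_or_pos n with h0 | h0
  · have hA0 : A = 0 := by
      ext c
      have := Finset.single_le_sum (f := fun c => A c) (fun _ _ => Nat.zero_le _) (Finset.mem_univ c)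
      simp; omega
    subst h0
    rw [hA0, coeff_zero_GG]
    simp only [Finsupp.coe_zero, Pi.zero_apply, eseq_zero, Finset.prod_const_one, eq_comm]
  · obtain ⟨c, hc⟩ : ∃ c, 0 < A c := by
      by_contra hcon
      push Not at hcon
      rw [Finset.sum_eq_zero (fun c _ => Nat.le_zero.1 (hcon c))] at hA
      omega
    have hAc : (A c : ℚ) ≠ 0 := by exact_mod_cast hc.ne'
    have hle : A c ≤ n := by
      rw [← hA]; exact Finset.single_le_sum (f := fun c => A c) (fun _ _ => Nat.zero_le _) (Finset.mem_univ c)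
    apply mul_left_cancel₀ hAc
    rw [coeff_rec hp]
    have key : ∀ q, isP p q → q ≤ w → q ≤ A c → coeff (A - Finsupp.single c q) (GG p σ (w - q)) =
        if n = w then eseq p (A c - q) * ∏ c' ∈ Finset.univ.erase c, eseq p (A c') else 0 := by
      intro q hq hqw hqc
      have hqpos : 0 < q := Nat.pos_of_ne_zero (by rintro rfl; exact not_isP_zero hp hq)
      have hval : ∀ c', (A - Finsupp.single c q) c' = if c' = c then A c - q else A c' := by
        intro c'
        by_cases h : c' = c
        · subst h; simp
        · simp [h, Finsupp.single_eq_of_ne]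
      have hsum : ∑ c', (A - Finsupp.single c q) c' = n - q := by
        rw [← Finset.add_sum_erase _ _ (Finset.mem_univ c)] at hA ⊢
        rw [hval c, if_pos rfl]
        have : ∑ x ∈ Finset.univ.erase c, (A - Finsupp.single c q) x = ∑ x ∈ Finset.univ.erase c, A x := by
          apply Finset.sum_congr rfl
          intro x hx
          rw [hval, if_neg (Finset.ne_of_mem_erase hx)]
        rw [this]; omega
      rw [ih (n - q) (by omega) _ _ hsum]
      have e : (n - q = w - q) ↔ n = w := by omega
      simp only [e]
      split_ifs
      · rw [← Finset.mul_prod_erase _ _ (Finset.mem_univ c), hval c, if_pos rfl]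
        congr 1
        apply Finset.prod_congr rfl
        intro x hx
        rw [hval, if_neg (Finset.ne_of_mem_erase hx)]
      · rfl
    by_cases hnw : n = w
    · rw [if_pos hnw, ← Finset.mul_prod_erase _ _ (Finset.mem_univ c), ← mul_assoc, eseq_rec hp, Finset.sum_mul]
      symm
      rw [Finset.sum_subset_zero_on_sdiff (s₂ := Finset.range (w+1))
        (g := fun q => if isP p q then (if q ≤ A c then coeff (A - Finsupp.single c q) (GG p σ (w - q)) else 0) else 0)]
      · intro q hq; rw [Finset.mem_range] at *; omega
      · intro q hq
        rw [Finset.mem_sdiff, Finset.mem_range, Finset.mem_range] at hq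
        rw [if_neg (by omega : ¬ q ≤ A c), ite_self]
      · intro q hq
        rw [Finset.mem_range] at hq
        split_ifs with h1 h2
        · rw [key q h1 (by omega) (by omega), if_pos hnw]
        · omega
        · simp
    · rw [if_neg hnw, mul_zero]
      apply Finset.sum_eq_zero
      intro q hq
      rw [Finset.mem_range] at hq
      split_ifs with h1 h2
      · rw [key q h1 (by omega) h2, if_neg hnw]
      · rfl
      · rfl

lemma GG_range {p : ℕ} (hp : p.Prime) (σ : Type*) [Fintype σ] (w : ℕ) :
    ∃ g : MvPolynomial σ (Zploc p hp), MvPolynomial.map (Zploc p hp).subtype g = GG p σ w := by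
  have : GG p σ w ∈ Set.range (MvPolynomial.map (Zploc p hp).subtype) := by
    rw [mem_range_map_iff_coeffs_subset]
    intro x hx
    obtain ⟨A, -, rfl⟩ := mem_coeffs_iff.1 (Finset.mem_coe.1 hx)
    refine ⟨⟨coeff A (GG p σ w), ?_⟩, rfl⟩
    rw [coeff_GG hp σ _ A w rfl]
    split_ifs
    · exact prod_mem fun c _ => eseq_mem hp _
    · exact zero_mem _
  exact this

end RE

namespace RE
open MvPolynomial

def ip (m : Multiset ℕ) (j : Fin (Multiset.card m)) : ℕ := (m.sort (· ≤ ·)).getD j 0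

lemma ip_map (m : Multiset ℕ) : (Finset.univ.val.map (ip m)) = m := by
  have h : ∀ (L : List ℕ) (n : ℕ), L.length = n →
      (Finset.univ.val.map (fun j : Fin n => L.getD j 0)) = (L : Multiset ℕ) := by
    rintro L n rfl
    rw [Fin.univ_val_map]
    congr 1
    apply List.ext_getElem
    · simp
    · intro i h1 h2; simp at h1 ⊢
  have := h (m.sort (· ≤ ·)) (Multiset.card m) (by simp)
  rw [Multiset.sort_eq] at this
  exact this

lemma ip_mem (m : Multiset ℕ) (i) : ip m i ∈ m := by
  have h : ip m i ∈ (Finset.univ.val.map (ip m)) := Multiset.mem_map_of_mem _ (Finset.mem_univ_val _)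
  rwa [ip_map] at h

lemma PP_eq (σ : Type*) [Fintype σ] (m : Multiset ℕ) : PP σ m = ∏ j, psum σ ℚ (ip m j) := by
  conv_lhs => rw [PP, ← ip_map m, Multiset.map_map]
  rfl

def af (m : Multiset ℕ) : Fin (Multiset.card m) →₀ ℕ := Finsupp.equivFunOnFinite.symm (ip m)

lemma Mcount_eq (lam mu : Multiset ℕ) :
    (Mcount lam mu : ℚ) = coeff (af lam) (PP (Fin (Multiset.card lam)) mu) := by
  rw [PP_eq]
  simp only [psum]
  rw [Finset.prod_univ_sum, coeff_sum]
  have h : ∀ f : Fin (Multiset.card mu) → Fin (Multiset.card lam),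
      coeff (af lam) (∏ j, (X (f j) : MvPolynomial (Fin (Multiset.card lam)) ℚ) ^ (ip mu j)) =
      if (∀ i, (∑ j ∈ Finset.univ.filter (fun j => f j = i), ip mu j) = ip lam i) then 1 else 0 := by
    intro f
    simp only [X_pow_eq_monomial]
    rw [← monomial_sum_one, coeff_monomial]
    congr 1
    apply propext
    rw [Finsupp.ext_iff]
    apply forall_congr'
    intro i
    rw [Finsupp.finsetSum_apply, Finset.sum_filter]
    simp only [Finsupp.single_apply]
    rfl
  simp only [h]
  rw [Fintype.piFinset_univ, Finset.sum_boole, Mcount, Fintype.card_subtype]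
  rfl

lemma V_mem {p : ℕ} (hp : p.Prime) (w : ℕ) (lam kap : Multiset ℕ) :
    ∑ μ : PowP p w, (Mcount lam μ.1.parts : ℚ) * (1 / (zMult μ.1.parts : ℚ)) * (Mcount kap μ.1.parts : ℚ) ∈ Zploc p hp := by
  let I := Fin (Multiset.card lam)
  let J := Fin (Multiset.card kap)
  obtain ⟨g, hg⟩ := GG_range hp (I × J) w
  let R := Zploc p hp
  let φR : MvPolynomial (I × J) R →+* MvPolynomial I (MvPolynomial J R) :=
    eval₂Hom (C.comp C) (fun ij => X ij.1 * C (X ij.2))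
  let φQ : MvPolynomial (I × J) ℚ →+* MvPolynomial I (MvPolynomial J ℚ) :=
    eval₂Hom (C.comp C) (fun ij => X ij.1 * C (X ij.2))
  have hcomm : φQ (map R.subtype g) = map (map R.subtype) (φR g) := by
    have : φQ.comp (map R.subtype) = (map (map R.subtype)).comp φR := by
      apply ringHom_ext
      · intro r; simp [φQ, φR]
      · intro i; simp [φQ, φR]
    exact RingHom.congr_fun this g
  have hPP : ∀ m : Multiset ℕ, φQ (PP (I × J) m) = map C (PP I m) * C (PP J m) := by
    intro m
    have hs : ∀ q, φQ (psum (I × J) ℚ q) = map C (psum I ℚ q) * C (psum J ℚ q) := by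
      intro q
      simp only [psum, map_sum, map_pow, map_X, φQ, eval₂Hom_X', mul_pow]
      rw [Finset.sum_mul_sum, Fintype.sum_prod_type]
    simp only [PP, map_multiset_prod, Multiset.map_map, ← Multiset.prod_map_mul]
    congr 1
    apply Multiset.map_congr rfl
    intro q _
    exact hs q
  have hval : ∑ μ : PowP p w, (Mcount lam μ.1.parts : ℚ) * (1 / (zMult μ.1.parts : ℚ)) * (Mcount kap μ.1.parts : ℚ)
      = coeff (af kap) (coeff (af lam) (φQ (GG p (I × J) w))) := by
    rw [GG, map_sum, coeff_sum, coeff_sum]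
    apply Finset.sum_congr rfl
    intro μ _
    rw [map_mul, hPP, Mcount_eq, Mcount_eq]
    have : φQ (C (1 / (zMult μ.1.parts : ℚ))) = C (C (1 / (zMult μ.1.parts : ℚ))) := by simp [φQ]
    rw [this, coeff_C_mul, mul_comm (map C _), coeff_C_mul, coeff_C_mul, coeff_map, mul_comm (PP J _), coeff_C_mul]
    ring
  rw [hval, ← hg, hcomm, coeff_map, coeff_map]
  exact Subtype.property _

lemma Mcount_lt {p w : ℕ} (lam mu : PowP p w) (h : Mcount lam.1.parts mu.1.parts ≠ 0) :
    lam = mu ∨ Multiset.card lam.1.parts < Multiset.card mu.1.parts := by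
  have h1 : 0 < Mcount lam.1.parts mu.1.parts := Nat.pos_of_ne_zero h
  obtain ⟨f, hf⟩ := Fintype.card_pos_iff.1 h1
  have hipos : ∀ i, 0 < ip lam.1.parts i := by
    intro i
    apply lam.1.parts_pos
    exact ip_mem _ i
  have hsurj : Function.Surjective f := by
    intro i
    by_contra hcon
    push Not at hcon
    have h2 := hf i
    rw [Finset.filter_false_of_mem (fun j _ => hcon j)] at h2
    have := hipos i
    rw [ip, ← h2] at this
    simp at this
  have hle := Fintype.card_le_of_surjective f hsurj
  rw [Fintype.card_fin, Fintype.card_fin] at hle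
  rcases hle.lt_or_eq with hlt | heq
  · exact Or.inr hlt
  · left
    have hbij : Function.Bijective f := (Fintype.bijective_iff_surjective_and_card f).2 ⟨hsurj, by simp [heq]⟩
    apply PowP_ext
    have e : ip mu.1.parts = ip lam.1.parts ∘ f := by
      funext j
      have h2 := hf (f j)
      have h3 : Finset.univ.filter (fun j' => f j' = f j) = {j} := by
        ext j'; simp [hbij.1.eq_iff]
      rw [h3, Finset.sum_singleton] at h2
      exact h2
    have h4 : Finset.univ.val.map f = (Finset.univ : Finset (Fin (Multiset.card lam.1.parts))).val := by
      have := congrArg Finset.val (Finset.map_univ_equiv (Equiv.ofBijective f hbij))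
      rw [Finset.map_val] at this
      exact this
    have h5 := ip_map mu.1.parts
    rw [e, ← Multiset.map_map, h4, ip_map] at h5
    exact h5

lemma Mcount_diag {p w : ℕ} (lam : PowP p w) :
    Mcount lam.1.parts lam.1.parts = ∏ i ∈ lam.1.parts.toFinset, (lam.1.parts.count i).factorial := by
  set m := lam.1.parts with hm
  have hipos : ∀ i, 0 < ip m i := by
    intro i
    apply lam.1.parts_pos
    exact ip_mem _ i
  have h1 : Mcount m m = Fintype.card {g : Equiv.Perm (Fin (Multiset.card m)) // ip m ∘ g = ip m} := by
    symm
    have hg : ∀ g : {g : Equiv.Perm (Fin (Multiset.card m)) // ip m ∘ g = ip m}, ∀ i,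
        (∑ j ∈ Finset.univ.filter (fun j => g.1 j = i), (m.sort (· ≤ ·)).getD j 0)
        = (m.sort (· ≤ ·)).getD i 0 := by
      intro g i
      have h3 : Finset.univ.filter (fun j => g.1 j = i) = {g.1.symm i} := by
        ext j'; simp [Equiv.eq_symm_apply]
      rw [h3, Finset.sum_singleton]
      have := congrFun g.2 (g.1.symm i)
      simp only [Function.comp, Equiv.apply_symm_apply] at this
      exact this.symm
    apply Fintype.card_of_bijective (f := fun g => ⟨g.1, hg g⟩)
    · constructor
      · intro a b hab
        apply Subtype.ext
        apply Equiv.ext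
        intro x
        exact congrFun (Subtype.ext_iff.1 hab) x
      · rintro ⟨f, hf⟩
        have hsurj : Function.Surjective f := by
          intro i
          by_contra hcon
          push Not at hcon
          have h2 := hf i
          rw [Finset.filter_false_of_mem (fun j _ => hcon j)] at h2
          have := hipos i
          rw [ip, ← h2] at this
          simp at this
        have hbij : Function.Bijective f := Finite.surjective_iff_bijective.1 hsurj
        refine ⟨⟨Equiv.ofBijective f hbij, ?_⟩, ?_⟩
        · funext j
          have h2 := hf (f j)
          have h3 : Finset.univ.filter (fun j' => f j' = f j) = {j} := by
            ext j'; simp [hbij.1.eq_iff]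
          rw [h3, Finset.sum_singleton] at h2
          exact h2.symm
        · rfl
  rw [h1, DomMulAct.stabilizer_card']
  have himg : Finset.univ.image (ip m) = m.toFinset := by
    conv_rhs => rw [← ip_map m]
    rfl
  rw [himg]
  apply Finset.prod_congr rfl
  intro i _
  congr 1
  conv_rhs => rw [← ip_map m, Multiset.count_map]
  rw [Fintype.card_subtype]
  simp only [eq_comm]
  rfl

end RE

namespace RE

def DD (p w y : ℕ) : ℕ := if y ≤ w then Fintype.card (PowP p (w - y)) else 0

lemma card_count {p : ℕ} (hp : p.Prime) (w n j : ℕ) :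
    (Finset.univ.filter (fun l : PowP p w => j ≤ l.1.parts.count (p^n))).card = DD p w (j * p^n) := by
  rw [DD]
  split_ifs with h
  · rw [← Finset.card_univ]
    refine Finset.card_bij' (fun l hl => mkP hp (l.1.parts - Multiset.replicate j (p^n))
        (fun i hi => l.2 i (Multiset.mem_of_le (Multiset.sub_le_self _ _) hi)) ?_)
      (fun ν _ => mkP hp (ν.1.parts + Multiset.replicate j (p^n)) ?_ ?_) ?_ ?_ ?_ ?_
    · have h1 := Multiset.le_count_iff_replicate_le.1 (Finset.mem_filter.1 hl).2
      have h2 := congrArg Multiset.sum (tsub_add_cancel_of_le h1)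
      rw [Multiset.sum_add, l.1.parts_sum, Multiset.sum_replicate, smul_eq_mul] at h2
      omega
    · intro i hi
      rcases Multiset.mem_add.1 hi with hi | hi
      · exact ν.2 i hi
      · exact ⟨n, Multiset.eq_of_mem_replicate hi⟩
    · rw [Multiset.sum_add, ν.1.parts_sum, Multiset.sum_replicate, smul_eq_mul]; omega
    · intros; exact Finset.mem_univ _
    · intro ν _
      refine Finset.mem_filter.2 ⟨Finset.mem_univ _, ?_⟩
      simp [mkP]
    · intro l hl
      exact PowP_ext (tsub_add_cancel_of_le (Multiset.le_count_iff_replicate_le.1 (Finset.mem_filter.1 hl).2))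
    · intro ν _
      exact PowP_ext (add_tsub_cancel_right _ _)
  · rw [Finset.card_eq_zero, Finset.filter_eq_empty_iff]
    intro l _ hl
    have h1 := Multiset.le_count_iff_replicate_le.1 hl
    have h2 := congrArg Multiset.sum (tsub_add_cancel_of_le h1)
    rw [Multiset.sum_add, l.1.parts_sum, Multiset.sum_replicate, smul_eq_mul] at h2
    omega

lemma count_mul_le {p w : ℕ} (l : PowP p w) (q : ℕ) : l.1.parts.count q * q ≤ w := by
  have h1 := Multiset.le_count_iff_replicate_le.1 (le_refl (l.1.parts.count q))
  have h2 := congrArg Multiset.sum (tsub_add_cancel_of_le h1)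
  rw [Multiset.sum_add, l.1.parts_sum, Multiset.sum_replicate, smul_eq_mul] at h2
  omega

def TT (p w x : ℕ) : ℕ := ∑ j ∈ Finset.Icc 1 w, DD p w (j * x)

lemma sum_count {p : ℕ} (hp : p.Prime) (w n d : ℕ) (hd : 0 < d) :
    ∑ l : PowP p w, l.1.parts.count (p^n) / d = TT p w (d * p^n) := by
  have h : ∀ l : PowP p w, l.1.parts.count (p^n) / d = ∑ j ∈ Finset.Icc 1 w, if j * d ≤ l.1.parts.count (p^n) then 1 else 0 := by
    intro l
    set m := l.1.parts.count (p^n) with hm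
    have hmw : m ≤ w := le_trans (Nat.le_mul_of_pos_right _ (pow_pos hp.pos n)) (count_mul_le l (p^n))
    have hmd : m / d ≤ w := (Nat.div_le_self _ _).trans hmw
    rw [Finset.sum_boole]
    have : (Finset.Icc 1 w).filter (fun j => j * d ≤ m) = Finset.Icc 1 (m / d) := by
      ext j
      simp only [Finset.mem_filter, Finset.mem_Icc, ← Nat.le_div_iff_mul_le hd]
      omega
    rw [this]; simp
  simp only [h]
  rw [Finset.sum_comm, TT]
  apply Finset.sum_congr rfl
  intro j _
  rw [Finset.sum_boole, card_count hp, mul_assoc]; rfl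

lemma sum_toFinset {p w : ℕ} (hp : p.Prime) (l : PowP p w) (f : ℕ → ℕ) (hf : ∀ i, i ∉ l.1.parts → f i = 0) :
    ∑ i ∈ l.1.parts.toFinset, f i = ∑ n ∈ Finset.range (w+1), f (p^n) := by
  rw [← Finset.sum_image (s := Finset.range (w+1)) (g := fun n => p^n) (f := f)
    (fun a _ b _ hab => Nat.pow_right_injective hp.two_le hab)]
  apply Finset.sum_subset
  · intro i hi
    rw [Multiset.mem_toFinset] at hi
    obtain ⟨n, rfl⟩ := l.2 i hi
    have h1 := Nat.Partition.le_of_mem_parts hi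
    have h2 := Nat.lt_pow_self hp.one_lt (n := n)
    exact Finset.mem_image.2 ⟨n, Finset.mem_range.2 (by omega), rfl⟩
  · intro i _ hi
    exact hf i (fun h => hi (Multiset.mem_toFinset.2 h))

def fA {p w : ℕ} (l : PowP p w) : ℕ := ∏ i ∈ l.1.parts.toFinset, (l.1.parts.count i).factorial
def fB {p w : ℕ} (l : PowP p w) : ℕ := ∏ i ∈ l.1.parts.toFinset, i ^ (l.1.parts.count i)

lemma fA_pos {p w : ℕ} (l : PowP p w) : 0 < fA l := Finset.prod_pos fun i _ => Nat.factorial_pos _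
lemma fB_pos {p w : ℕ} (l : PowP p w) : 0 < fB l := Finset.prod_pos fun i hi =>
  pow_pos (l.1.parts_pos (Multiset.mem_toFinset.1 hi)) _

lemma fact_A {p : ℕ} (hp : p.Prime) (w : ℕ) :
    (∏ l : PowP p w, fA l).factorization p = ∑ n ∈ Finset.range (w+1), n * TT p w (p^n) := by
  rw [Nat.factorization_prod_apply (fun l _ => (fA_pos l).ne')]
  have h : ∀ l : PowP p w, (fA l).factorization p =
      ∑ n ∈ Finset.range (w+1), ∑ n' ∈ Finset.Ico (n+1) (w+1), l.1.parts.count (p^n) / p^(n' - n) := by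
    intro l
    rw [fA, Nat.factorization_prod_apply (fun i _ => (Nat.factorial_ne_zero _)),
      sum_toFinset hp l (fun i => (l.1.parts.count i).factorial.factorization p)]
    · apply Finset.sum_congr rfl
      intro n hn
      rw [Finset.mem_range] at hn
      set m := l.1.parts.count (p^n) with hm
      have hmw : m * p^n ≤ w := count_mul_le l (p^n)
      have hlog : Nat.log p m < w + 1 - n := by
        rcases Nat.eq_zero_or_pos m with h0 | h0
        · rw [h0]; simp; omega
        · have h1 := Nat.pow_log_le_self p h0.ne'
          have h2 : p ^ (Nat.log p m + n) ≤ w := by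
            rw [pow_add]; exact (Nat.mul_le_mul_right _ h1).trans hmw
          have h3 := Nat.lt_pow_self hp.one_lt (n := Nat.log p m + n)
          omega
      rw [Nat.factorization_factorial hp hlog]
      rw [Finset.sum_Ico_eq_sum_range, Finset.sum_Ico_eq_sum_range]
      have e : w + 1 - n - 1 = w + 1 - (n+1) := by omega
      rw [e]
      apply Finset.sum_congr rfl
      intro k _
      congr 2; omega
    · intro i hi
      simp [Multiset.count_eq_zero_of_notMem hi]
  simp only [h]
  rw [Finset.sum_comm]
  have h2 : ∀ n ∈ Finset.range (w+1), ∑ l : PowP p w, ∑ n' ∈ Finset.Ico (n+1) (w+1), l.1.parts.count (p^n) / p^(n' - n)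
      = ∑ n' ∈ Finset.Ico (n+1) (w+1), TT p w (p^n') := by
    intro n _
    rw [Finset.sum_comm]
    apply Finset.sum_congr rfl
    intro n' hn'
    rw [Finset.mem_Ico] at hn'
    rw [sum_count hp w n _ (pow_pos hp.pos _), ← pow_add, Nat.sub_add_cancel (by omega)]
  rw [Finset.sum_congr rfl h2, Finset.sum_comm' (t' := Finset.range (w+1)) (s' := fun n' => Finset.range n')]
  · simp
  · intro a b
    simp only [Finset.mem_range, Finset.mem_Ico]; omega

lemma fact_B {p : ℕ} (hp : p.Prime) (w : ℕ) :
    (∏ l : PowP p w, fB l).factorization p = ∑ n ∈ Finset.range (w+1), n * TT p w (p^n) := by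
  rw [Nat.factorization_prod_apply (fun l _ => (fB_pos l).ne')]
  have h : ∀ l : PowP p w, (fB l).factorization p =
      ∑ n ∈ Finset.range (w+1), n * (l.1.parts.count (p^n) / 1) := by
    intro l
    rw [fB, Nat.factorization_prod_apply (fun i hi => (pow_pos (l.1.parts_pos (Multiset.mem_toFinset.1 hi)) _).ne'),
      sum_toFinset hp l (fun i => (i ^ l.1.parts.count i).factorization p)]
    · apply Finset.sum_congr rfl
      intro n hn
      simp [Nat.factorization_pow, hp.factorization_self, mul_comm]
    · intro i hi
      simp [Multiset.count_eq_zero_of_notMem hi]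
  simp only [h]
  rw [Finset.sum_comm]
  apply Finset.sum_congr rfl
  intro n _
  rw [← Finset.mul_sum, sum_count hp w n 1 one_pos, one_mul]

lemma ratio_mem {p : ℕ} (hp : p.Prime) (a b : ℕ) (ha : a ≠ 0) (hb : b ≠ 0) (h : a.factorization p = b.factorization p) :
    (a : ℚ) / b ∈ Zploc p hp := by
  have ea := Nat.ordProj_mul_ordCompl_eq_self a p
  have eb := Nat.ordProj_mul_ordCompl_eq_self b p
  have hnd := Nat.not_dvd_ordCompl hp hb
  rw [h] at ea
  generalize b.factorization p = k at *
  generalize a / p ^ k = a' at *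
  generalize b / p ^ k = b' at *
  have hpp : ((p:ℚ) ^ k) ≠ 0 := pow_ne_zero _ (by exact_mod_cast hp.ne_zero)
  refine ⟨(a' : ℤ), (b' : ℤ), ?_, ?_⟩
  · intro hd
    exact hnd (by exact_mod_cast hd)
  · rw [← ea, ← eb]
    push_cast
    rw [mul_div_mul_left _ _ hpp]

lemma prod_z (p w : ℕ) : ∏ l : PowP p w, (1 / (zMult l.1.parts : ℚ)) =
    1 / (((∏ l : PowP p w, fB l : ℕ) : ℚ) * ((∏ l : PowP p w, fA l : ℕ) : ℚ)) := by
  rw [Finset.prod_div_distrib, Finset.prod_const_one, ← Nat.cast_mul, ← Finset.prod_mul_distrib,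
    ← Nat.cast_prod]
  congr 2
  apply Finset.prod_congr rfl
  intro l _
  rw [zMult, Finset.prod_mul_distrib]
  rfl

lemma linalg {n : Type*} [Fintype n] [DecidableEq n] (R : Subring ℚ) (N : Matrix n n ℚ) (z : n → ℚ)
    (hz0 : ∀ l, z l ≠ 0) (a b : ℚ) (ha : a ≠ 0) (hb : b ≠ 0)
    (hV : ∀ i j, (N * Matrix.diagonal (fun l => 1 / z l) * N.transpose) i j ∈ R)
    (hdetN : N.det = a) (hzp : ∏ l, (1 / z l) = 1 / (b * a)) (hba : b / a ∈ R) :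
    ∃ U : Matrix n n R, IsUnit U ∧
      N.transpose⁻¹ * Matrix.diagonal z = U.map (fun x => (x : ℚ)) * N := by
  obtain ⟨zi, hzi⟩ : ∃ zi : n → ℚ, zi = fun l => 1 / z l := ⟨_, rfl⟩
  have hzzi : Matrix.diagonal zi * Matrix.diagonal z = 1 := by
    rw [Matrix.diagonal_mul_diagonal, ← Matrix.diagonal_one]
    congr 1; funext l
    rw [hzi]
    exact one_div_mul_cancel (hz0 l)
  rw [← hzi] at hV
  have hzp' : ∏ l, zi l = 1 / (b * a) := by rw [hzi]; exact hzp
  obtain ⟨V, hVd⟩ : ∃ V, V = N * Matrix.diagonal zi * N.transpose := ⟨_, rfl⟩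
  rw [← hVd] at hV
  obtain ⟨V', hV'⟩ : ∃ V' : Matrix n n R, V'.map R.subtype = V :=
    ⟨Matrix.of fun i j => ⟨V i j, hV i j⟩, by ext i j; rfl⟩
  have hdetV : V.det = a / b := by
    rw [hVd, Matrix.det_mul, Matrix.det_mul, Matrix.det_transpose, Matrix.det_diagonal, hdetN, hzp']
    field_simp
  have hdet' : R.subtype V'.det = a / b := by
    rw [← hdetV, ← hV']
    exact RingHom.map_det R.subtype V'
  have hunit : IsUnit V'.det := by
    apply IsUnit.of_mul_eq_one (⟨b / a, hba⟩ : R)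
    apply Subtype.ext
    change R.subtype V'.det * (b / a) = 1
    rw [hdet']
    field_simp
  have hVu : IsUnit V' := (Matrix.isUnit_iff_isUnit_det V').2 hunit
  refine ⟨V'⁻¹, (Matrix.isUnit_nonsing_inv_iff).2 hVu, ?_⟩
  have h1 : (V'⁻¹).map R.subtype * V = 1 := by
    rw [← hV', ← Matrix.map_mul, Matrix.nonsing_inv_mul _ hunit]
    simp
  change N.transpose⁻¹ * Matrix.diagonal z = (V'⁻¹).map R.subtype * N
  have h2 : (V'⁻¹).map R.subtype * N * Matrix.diagonal zi * N.transpose = 1 := by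
    rw [← h1, hVd]; simp only [Matrix.mul_assoc]
  have h3 : N.transpose⁻¹ = (V'⁻¹).map R.subtype * N * Matrix.diagonal zi := Matrix.inv_eq_left_inv h2
  rw [h3, Matrix.mul_assoc, hzzi, Matrix.mul_one]

lemma det_N {p : ℕ} (w : ℕ) : (Nmat p w).det = ∏ l : PowP p w, (fA l : ℚ) := by
  rw [Matrix.det_apply, Finset.sum_eq_single 1]
  · simp only [Equiv.Perm.sign_one, one_smul, Equiv.Perm.one_apply]
    apply Finset.prod_congr rfl
    intro l _
    rw [Nmat, Matrix.of_apply, Mcount_diag]; rfl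
  · intro s _ hs
    have : ∏ i, Nmat p w (s i) i = 0 := by
      by_contra hne
      apply hs
      have h1 : ∀ i, s i = i ∨ Multiset.card (s i).1.parts < Multiset.card i.1.parts := by
        intro i
        apply Mcount_lt
        have := Finset.prod_ne_zero_iff.1 hne i (Finset.mem_univ i)
        rw [Nmat, Matrix.of_apply] at this
        exact_mod_cast this
      have h2 : ∑ i, Multiset.card (s i).1.parts = ∑ i : PowP p w, Multiset.card i.1.parts :=
        Equiv.sum_comp s (fun i => Multiset.card i.1.parts)
      have h3 := (Finset.sum_eq_sum_iff_of_le (s := Finset.univ) (f := fun i => Multiset.card (s i).1.parts)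
        (g := fun i : PowP p w => Multiset.card i.1.parts) (fun i _ => by
          rcases h1 i with h | h
          · rw [h]
          · exact h.le)).1 h2
      ext1 i
      rcases h1 i with h | h
      · exact h
      · have := h3 i (Finset.mem_univ i); omega
    rw [this, smul_zero]
  · simp

end RE

/-- **Lemma 5.1.** The matrix `N` is row equivalent over `ℤ_(p)` to `(N^T)⁻¹ z`, where `z` is
the diagonal matrix with entries `z_λ`. -/
theorem N_rowequiv (p : ℕ) (hp : p.Prime) (w : ℕ) :
    ∃ U : Matrix (PowP p w) (PowP p w) (Zploc p hp),
      IsUnit U ∧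
        ((Nmat p w).transpose)⁻¹ *
            Matrix.diagonal (fun lam : PowP p w => (zMult lam.1.parts : ℚ))
          = U.map (fun x => (x : ℚ)) * Nmat p w := by
  have hA0 : (∏ l : PowP p w, RE.fA l) ≠ 0 := (Finset.prod_pos fun l _ => RE.fA_pos l).ne'
  have hB0 : (∏ l : PowP p w, RE.fB l) ≠ 0 := (Finset.prod_pos fun l _ => RE.fB_pos l).ne'
  refine RE.linalg (Zploc p hp) (Nmat p w) _ ?_ ((∏ l : PowP p w, RE.fA l : ℕ) : ℚ)
    ((∏ l : PowP p w, RE.fB l : ℕ) : ℚ) (Nat.cast_ne_zero.2 hA0) (Nat.cast_ne_zero.2 hB0) ?_ ?_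
    (RE.prod_z p w) (RE.ratio_mem hp _ _ hB0 hA0 (by rw [RE.fact_A hp, RE.fact_B hp]))
  · intro l
    exact Nat.cast_ne_zero.2 (RE.zMult_pos l).ne'
  · intro i j
    have := RE.V_mem hp w i.1.parts j.1.parts
    convert this using 1
    rw [Matrix.mul_apply]
    apply Finset.sum_congr rfl
    intro k _
    rw [Matrix.mul_diagonal, Matrix.transpose_apply]
    rfl
  · rw [RE.det_N, Nat.cast_prod]

end
end

section
/- Fix a prime p, r ≥ 0, and w ≥ 0, and let U = (x^{<r})^{-1} N C^{-1}. Then for all λ, μ ∈ Pow(w): (i) U_{λμ} ∈ ℤ_(p); (ii) U_{λμ} = δ_{λμ} whenever λ̄ = μ̄; (iii) v_p(U_{λμ}) > k_λ − k_μ whenever λ̄ ≠ μ̄. -/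
open scoped BigOperators
open Classical

noncomputable section

/-- `d_p(k) = v_p(k!)`. -/
def dval (p k : ℕ) : ℕ := padicValNat p (Nat.factorial k)

/-- `c_{p,r}(λ) = ∑_{j ≥ 1, v_p(j) < r} ((r - v_p(j)) m_j(λ) + d_p(m_j(λ)))`. -/
def cpr (p r : ℕ) (lam : Multiset ℕ) : ℕ :=
  ∑ j ∈ lam.toFinset.filter (fun j => padicValNat p j < r),
    ((r - padicValNat p j) * lam.count j + dval p (lam.count j))

/-- `ϑ_λ(ℓ) = ∏_{p^r ∥ ℓ} p^{c_{p,r}(λ)}`, with `ϑ_λ(0) = 0`. -/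
def theta (lam : Multiset ℕ) (l : ℕ) : ℚ :=
  if l = 0 then 0 else ∏ q ∈ l.primeFactors, (q : ℚ) ^ cpr q (padicValNat q l) lam

/-- The partition `λ^{≥ r}`: `n_i(λ^{≥r}) = n_{r+i}(λ)`; concretely, keep the parts `≥ p^r`
and divide them by `p^r`. -/
def lamGeq (p r : ℕ) (lam : Multiset ℕ) : Multiset ℕ :=
  (lam.filter (fun j => p ^ r ≤ j)).map (fun j => j / p ^ r)

/-- The partition `λ̄`, obtained from `λ` by splitting every part of size at least `p^r` into
parts of size exactly `p^r`. -/
def lamBar (p r : ℕ) (lam : Multiset ℕ) : Multiset ℕ :=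
  lam.filter (fun j => j < p ^ r) +
    Multiset.replicate ((lam.filter (fun j => p ^ r ≤ j)).sum / p ^ r) (p ^ r)

/-- The block-diagonal matrix `C`: `C_{λμ} = N^{(|λ^{≥r}|)}_{λ^{≥r}, μ^{≥r}}` if `λ̄ = μ̄`,
and `0` otherwise. -/
def Cmat (p r w : ℕ) : Matrix (PowP p w) (PowP p w) ℚ :=
  Matrix.of fun lam mu =>
    if lamBar p r lam.1.parts = lamBar p r mu.1.parts then
      (Mcount (lamGeq p r lam.1.parts) (lamGeq p r mu.1.parts) : ℚ)
    else 0

/-- The diagonal matrix `x^{<r}` with entries `x^{<r}_λ = ∏_{0 ≤ i < r} n_i(λ)!`. -/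
def xLess (p r w : ℕ) : Matrix (PowP p w) (PowP p w) ℚ :=
  Matrix.diagonal
    (fun lam : PowP p w =>
      ((∏ i ∈ Finset.range r, (lam.1.parts.count (p ^ i)).factorial : ℕ) : ℚ))

/-- `e_λ = ∑_{0 ≤ i < r} d_p(n_i(λ))`. -/
def eVal (p r : ℕ) (lam : Multiset ℕ) : ℕ :=
  ∑ i ∈ Finset.range r, dval p (lam.count (p ^ i))

/-- `f_λ = ∑_{0 ≤ i < r} (r - i) n_i(λ)`. -/
def fVal (p r : ℕ) (lam : Multiset ℕ) : ℕ :=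
  ∑ i ∈ Finset.range r, (r - i) * lam.count (p ^ i)

/-- `k_λ = f_λ - e_λ`. -/
def kVal (p r : ℕ) (lam : Multiset ℕ) : ℤ := (fVal p r lam : ℤ) - (eVal p r lam : ℤ)


/-- Counting maps with prescribed block sums, for arbitrary finite families. -/
def Cnt {ι κ : Type} [Fintype ι] [Fintype κ] (a : ι → ℕ) (b : κ → ℕ) : ℕ :=
  Fintype.card {f : κ → ι // ∀ i, (∑ j ∈ Finset.univ.filter (fun j => f j = i), b j) = a i}

theorem count_map_univ {ι : Type} [Fintype ι] (a : ι → ℕ) (v : ℕ) :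
    (Finset.univ.val.map a).count v = Fintype.card {i // a i = v} := by
  rw [Multiset.count_map, Fintype.card_subtype]
  simp only [eq_comm]
  rfl

theorem exists_equiv_of_map_eq {ι κ : Type} [Fintype ι] [Fintype κ] (a : ι → ℕ) (b : κ → ℕ)
    (h : Finset.univ.val.map a = Finset.univ.val.map b) :
    ∃ e : ι ≃ κ, ∀ i, a i = b (e i) := by
  have hc : ∀ v, Nonempty ({i // a i = v} ≃ {j // b j = v}) := fun v => by
    rw [← Fintype.card_eq, ← count_map_univ, ← count_map_univ, h]
  let e := fun v => (hc v).some
  refine ⟨(Equiv.sigmaFiberEquiv a).symm.trans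
    ((Equiv.sigmaCongrRight e).trans (Equiv.sigmaFiberEquiv b)), fun i => ?_⟩
  exact (e (a i) ⟨i, rfl⟩).2.symm

theorem exists_equiv_of_map {ι : Type} [Fintype ι] (a : ι → ℕ) (A : Multiset ℕ)
    (h : Finset.univ.val.map a = A) :
    ∃ e : Fin (Multiset.card A) ≃ ι,
      ∀ i : Fin (Multiset.card A), (A.sort (· ≤ ·)).getD i 0 = a (e i) := by
  have h2 : Finset.univ.val.map (fun i : Fin (Multiset.card A) => (A.sort (· ≤ ·)).getD i 0)
      = A := by
    conv_rhs => rw [← Multiset.sort_eq A (· ≤ ·)]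
    have : List.ofFn (fun i : Fin (Multiset.card A) => (A.sort (· ≤ ·)).getD i 0)
        = A.sort (· ≤ ·) := by
      apply List.ext_getElem
      · simp
      · intro i h1 h2
        simp
    conv_rhs => rw [← this]
    rw [← Fin.univ_val_map]
  exact exists_equiv_of_map_eq _ a (h2.trans h.symm)

theorem Cnt_congr {ι κ ι' κ' : Type} [Fintype ι] [Fintype κ] [Fintype ι'] [Fintype κ']
    (e : ι' ≃ ι) (e' : κ' ≃ κ) (a : ι → ℕ) (b : κ → ℕ) :
    Cnt (a ∘ e) (b ∘ e') = Cnt a b := by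
  unfold Cnt
  refine Fintype.card_congr (Equiv.subtypeEquiv (Equiv.arrowCongr e' e) ?_)
  intro f
  rw [← e.forall_congr_right]
  refine forall_congr' fun i => ?_
  simp only [Function.comp]
  rw [Finset.sum_filter, Finset.sum_filter, ← e'.sum_comp]
  simp

theorem Mcount_eq_Cnt {ι κ : Type} [Fintype ι] [Fintype κ] (a : ι → ℕ) (b : κ → ℕ)
    (A B : Multiset ℕ) (hA : Finset.univ.val.map a = A) (hB : Finset.univ.val.map b = B) :
    Mcount A B = Cnt a b := by
  obtain ⟨e, he⟩ := exists_equiv_of_map a A hA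
  obtain ⟨e', he'⟩ := exists_equiv_of_map b B hB
  rw [← Cnt_congr e e']
  unfold Cnt Mcount
  simp only [← Nat.card_eq_fintype_card]
  refine Nat.card_congr (Equiv.subtypeEquivRight ?_)
  intro f
  simp only [Function.comp, he, he']
  refine forall_congr' fun i => ?_
  constructor <;> intro h <;> convert h using 2 <;> ext <;> simp

/-- The tautological family of a multiset. -/
abbrev fam (B : Multiset ℕ) : B.ToType → ℕ := fun x => x.1

theorem fam_map (B : Multiset ℕ) : Finset.univ.val.map (fam B) = B := Multiset.map_univ_coe B

theorem Mcount_fam (A B : Multiset ℕ) : Mcount A B = Cnt (fam A) (fam B) :=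
  Mcount_eq_Cnt _ _ _ _ (fam_map A) (fam_map B)

/-- Product of power sums. -/
def Phi (ι : Type) [Fintype ι] (B : Multiset ℕ) : MvPolynomial ι ℕ :=
  (B.map (fun b => ∑ i : ι, (MvPolynomial.X i) ^ b)).prod

theorem Phi_coeff {ι κ : Type} [Fintype ι] [Fintype κ] (a : ι →₀ ℕ) (b : κ → ℕ) :
    (Phi ι (Finset.univ.val.map b)).coeff a = Cnt a b := by
  unfold Phi Cnt
  rw [Multiset.map_map]
  change (∏ j : κ, ∑ i : ι, (MvPolynomial.X i : MvPolynomial ι ℕ) ^ b j).coeff a = _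
  rw [Finset.prod_univ_sum, Fintype.piFinset_univ, MvPolynomial.coeff_sum, Fintype.card_subtype,
    Finset.card_filter]
  refine Finset.sum_congr rfl fun f _ => ?_
  have : ∏ j : κ, (MvPolynomial.X (f j) : MvPolynomial ι ℕ) ^ b j
      = MvPolynomial.monomial (∑ j, Finsupp.single (f j) (b j)) 1 := by
    rw [MvPolynomial.monomial_sum_one]
    refine Finset.prod_congr rfl fun j _ => ?_
    rw [MvPolynomial.X_pow_eq_monomial]
  rw [this, MvPolynomial.coeff_monomial]
  refine if_congr ?_ rfl rfl
  rw [Finsupp.ext_iff]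
  refine forall_congr' fun i => ?_
  rw [Finsupp.finsetSum_apply, Finset.sum_filter]
  simp [Finsupp.single_apply]

theorem Mcount_eq_coeff {ι : Type} [Fintype ι] (a : ι →₀ ℕ) (A B : Multiset ℕ)
    (hA : Finset.univ.val.map a = A) : Mcount A B = (Phi ι B).coeff a := by
  rw [Mcount_eq_Cnt a (fam B) A B hA (fam_map B), ← Phi_coeff, fam_map]

/-- Splitting the items. -/
theorem Mcount_add_right {ι : Type} [Fintype ι] (a : ι →₀ ℕ) (B₁ B₂ : Multiset ℕ) :
    Mcount (Finset.univ.val.map a) (B₁ + B₂) =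
      ∑ s ∈ Finset.HasAntidiagonal.antidiagonal a, Mcount (Finset.univ.val.map s.1) B₁ *
        Mcount (Finset.univ.val.map s.2) B₂ := by
  rw [Mcount_eq_coeff a _ _ rfl]
  have : Phi ι (B₁ + B₂) = Phi ι B₁ * Phi ι B₂ := by simp [Phi]
  rw [this, MvPolynomial.coeff_mul]
  refine Finset.sum_congr rfl fun s _ => ?_
  rw [Mcount_eq_coeff s.1 _ _ rfl, Mcount_eq_coeff s.2 _ _ rfl]

theorem coeff_rename_mul {ι ι' : Type} (a : ι →₀ ℕ) (a' : ι' →₀ ℕ)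
    (P : MvPolynomial ι ℕ) (Q : MvPolynomial ι' ℕ) :
    (MvPolynomial.rename Sum.inl P * MvPolynomial.rename Sum.inr Q).coeff (Finsupp.sumElim a a')
      = P.coeff a * Q.coeff a' := by
  induction P using MvPolynomial.induction_on' with
  | add p q hp hq => simp only [map_add, add_mul, MvPolynomial.coeff_add, hp, hq]
  | monomial u c =>
    induction Q using MvPolynomial.induction_on' with
    | add p q hp hq => simp only [map_add, mul_add, MvPolynomial.coeff_add, hp, hq]
    | monomial v d =>
      rw [MvPolynomial.rename_monomial, MvPolynomial.rename_monomial, MvPolynomial.monomial_mul,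
        MvPolynomial.coeff_monomial, MvPolynomial.coeff_monomial, MvPolynomial.coeff_monomial]
      have : (Finsupp.mapDomain Sum.inl u + Finsupp.mapDomain Sum.inr v : (ι ⊕ ι') →₀ ℕ)
          = Finsupp.sumElim a a' ↔ u = a ∧ v = a' := by
        constructor
        · intro h
          constructor
          · ext i
            have := DFunLike.congr_fun h (Sum.inl i)
            simpa [Finsupp.mapDomain_apply Sum.inl_injective, Finsupp.mapDomain_of_notMem_range] using this
          · ext i
            have := DFunLike.congr_fun h (Sum.inr i)
            simpa [Finsupp.mapDomain_apply Sum.inr_injective, Finsupp.mapDomain_of_notMem_range] using this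
        · rintro ⟨rfl, rfl⟩
          ext (i | i)
          · simp [Finsupp.mapDomain_apply Sum.inl_injective, Finsupp.mapDomain_of_notMem_range]
          · simp [Finsupp.mapDomain_apply Sum.inr_injective, Finsupp.mapDomain_of_notMem_range]
      rw [if_congr this rfl rfl]
      by_cases h1 : u = a <;> by_cases h2 : v = a' <;> simp [h1, h2]

/-- Splitting the slots. -/
theorem Mcount_add_left (A E B : Multiset ℕ) :
    Mcount (A + E) B = (B.antidiagonal.map (fun x => Mcount A x.1 * Mcount E x.2)).sum := by
  let a : A.ToType →₀ ℕ := Finsupp.equivFunOnFinite.symm (fam A)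
  let e : E.ToType →₀ ℕ := Finsupp.equivFunOnFinite.symm (fam E)
  have ha : Finset.univ.val.map a = A := fam_map A
  have he : Finset.univ.val.map e = E := fam_map E
  have hs : Finset.univ.val.map (Finsupp.sumElim a e) = A + E := by
    conv_rhs => rw [← ha, ← he]
    change Multiset.map _ (Multiset.disjSum _ _) = _
    simp [Multiset.disjSum, Multiset.map_map, Function.comp_def]
  rw [Mcount_eq_coeff _ _ _ hs]
  have : Phi (A.ToType ⊕ E.ToType) B = (B.antidiagonal.map (fun x =>
      MvPolynomial.rename Sum.inl (Phi A.ToType x.1) * MvPolynomial.rename Sum.inr (Phi E.ToType x.2))).sum := by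
    unfold Phi
    simp only [Fintype.sum_sum_type]
    rw [Multiset.prod_map_add]
    congr 1
    refine Multiset.map_congr rfl fun x _ => ?_
    simp [map_multiset_prod, Multiset.map_map]
  rw [this, ← MvPolynomial.coeffAddMonoidHom_apply, map_multiset_sum, Multiset.map_map]
  congr 1
  refine Multiset.map_congr rfl fun x _ => ?_
  simp only [Function.comp, MvPolynomial.coeffAddMonoidHom_apply]
  rw [coeff_rename_mul, Mcount_eq_coeff a _ _ ha, Mcount_eq_coeff e _ _ he]

/-- Block weights of a map. -/
def wt {ι κ : Type} [Fintype κ] (b : κ → ℕ) (f : κ → ι) : ι → ℕ :=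
  fun i => ∑ j, if f j = i then b j else 0

theorem Cnt_eq_card {ι κ : Type} [Fintype ι] [Fintype κ] (a : ι → ℕ) (b : κ → ℕ) :
    Cnt a b = (Finset.univ.filter (fun f : κ → ι => wt b f = a)).card := by
  unfold Cnt
  rw [Fintype.card_subtype]
  congr 1
  ext f
  simp only [Finset.mem_filter, Finset.mem_univ, true_and, funext_iff, wt, Finset.sum_filter]

theorem sum_wt {ι κ : Type} [Fintype ι] [Fintype κ] (b : κ → ℕ) (f : κ → ι) :
    ∑ i, wt b f i = ∑ j, b j := by
  unfold wt
  rw [Finset.sum_comm]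
  simp

theorem Mcount_sum {A B : Multiset ℕ} (h : Mcount A B ≠ 0) : A.sum = B.sum := by
  rw [Mcount_fam, Cnt_eq_card, Finset.card_ne_zero] at h
  obtain ⟨f, hf⟩ := h
  simp only [Finset.mem_filter, Finset.mem_univ, true_and] at hf
  have := sum_wt (fam B) f
  rw [hf] at this
  have e1 : ∀ C : Multiset ℕ, ∑ x, fam C x = C.sum := fun C => by
    conv_rhs => rw [← fam_map C]
    rfl
  rw [e1, e1] at this
  exact this

theorem wt_row {ι ι' κ : Type} [Fintype ι] [Fintype ι'] [Fintype κ] (b : κ → ℕ)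
    (h : κ → ι × ι') (i : ι) : ∑ i', wt b h (i, i') = wt b (fun j => (h j).1) i := by
  unfold wt
  rw [Finset.sum_comm]
  refine Finset.sum_congr rfl fun j _ => ?_
  rcases hj : h j with ⟨u, v⟩
  by_cases h1 : u = i <;> simp [h1, hj]

theorem wt_col {ι ι' κ : Type} [Fintype ι] [Fintype ι'] [Fintype κ] (b : κ → ℕ)
    (h : κ → ι × ι') (i' : ι') : ∑ i, wt b h (i, i') = wt b (fun j => (h j).2) i' := by
  unfold wt
  rw [Finset.sum_comm]
  refine Finset.sum_congr rfl fun j _ => ?_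
  rcases hj : h j with ⟨u, v⟩
  by_cases h1 : v = i' <;> simp [h1, hj]

/-- The set of matrices with given row and column sums. -/
def matSet {ι ι' : Type} [Fintype ι] [Fintype ι'] (a : ι → ℕ) (a' : ι' → ℕ) :
    Finset (ι × ι' → ℕ) :=
  (Fintype.piFinset (fun _ => Finset.range (∑ i, a i + 1))).filter
    (fun Z => (∀ i, ∑ i', Z (i, i') = a i) ∧ ∀ i', ∑ i, Z (i, i') = a' i')

theorem Cnt_mul {ι ι' κ : Type} [Fintype ι] [Fintype ι'] [Fintype κ] (a : ι → ℕ) (a' : ι' → ℕ)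
    (b : κ → ℕ) : Cnt a b * Cnt a' b = ∑ Z ∈ matSet a a', Cnt Z b := by
  simp only [Cnt_eq_card]
  rw [← Finset.card_product]
  have h1 : ((Finset.univ.filter (fun f : κ → ι => wt b f = a)) ×ˢ
      (Finset.univ.filter (fun f : κ → ι' => wt b f = a'))).card =
      (Finset.univ.filter (fun h : κ → ι × ι' => wt b (fun j => (h j).1) = a ∧
        wt b (fun j => (h j).2) = a')).card := by
    refine Finset.card_bij (fun x _ j => (x.1 j, x.2 j)) ?_ ?_ ?_
    · intro x hx
      simpa using hx
    · intro x _ y _ hxy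
      refine Prod.ext (funext fun j => ?_) (funext fun j => ?_)
      · exact congrArg Prod.fst (congrFun hxy j)
      · exact congrArg Prod.snd (congrFun hxy j)
    · intro h hh
      refine ⟨(fun j => (h j).1, fun j => (h j).2), ?_, rfl⟩
      simpa using hh
  rw [h1, Finset.card_eq_sum_card_fiberwise (f := fun h => wt b h) (t := matSet a a')]
  · refine Finset.sum_congr rfl fun Z hZ => ?_
    congr 1
    ext h
    simp only [Finset.mem_filter, Finset.mem_univ, true_and]
    refine ⟨fun x => x.2, fun x => ⟨⟨?_, ?_⟩, x⟩⟩
    · funext i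
      rw [← wt_row, x]
      exact (Finset.mem_filter.1 hZ).2.1 i
    · funext i
      rw [← wt_col, x]
      exact (Finset.mem_filter.1 hZ).2.2 i
  · intro h hh
    simp only [Finset.coe_filter, Finset.mem_univ, true_and, Set.mem_ofPred_eq] at hh
    rw [Finset.mem_coe, matSet, Finset.mem_filter]
    refine ⟨?_, fun i => ?_, fun i => ?_⟩
    · rw [Fintype.mem_piFinset]
      rintro ⟨i, i'⟩
      rw [Finset.mem_range, Nat.lt_succ_iff]
      calc wt b h (i, i') ≤ ∑ i', wt b h (i, i') :=
            Finset.single_le_sum (f := fun i' => wt b h (i, i')) (by simp) (Finset.mem_univ i')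
        _ = a i := by rw [wt_row, hh.1]
        _ ≤ _ := Finset.single_le_sum (f := a) (by simp) (Finset.mem_univ i)
    · rw [wt_row, hh.1]
    · rw [wt_col, hh.2]

theorem Mcount_mul (A A' : Multiset ℕ) : ∃ S : Finset (A.ToType × A'.ToType → ℕ),
    (∀ B, Mcount A B * Mcount A' B = ∑ Z ∈ S, Mcount (Finset.univ.val.map Z) B) ∧
    ∀ Z ∈ S, (Finset.univ.val.map Z).sum = A.sum ∧
      ∀ z ∈ Finset.univ.val.map Z, ∃ x ∈ A, z ≤ x := by
  refine ⟨matSet (fam A) (fam A'), fun B => ?_, fun Z hZ => ?_⟩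
  · rw [Mcount_fam, Mcount_fam, Cnt_mul]
    refine Finset.sum_congr rfl fun Z _ => ?_
    rw [Mcount_eq_Cnt Z (fam B) _ _ rfl (fam_map B)]
  · have hr := (Finset.mem_filter.1 hZ).2.1
    constructor
    · change ∑ x, Z x = _
      rw [Fintype.sum_prod_type]
      simp only [hr]
      conv_rhs => rw [← fam_map A]
      rfl
    · intro z hz
      rw [Multiset.mem_map] at hz
      obtain ⟨⟨i, i'⟩, -, rfl⟩ := hz
      refine ⟨fam A i, Multiset.coe_mem, ?_⟩
      rw [← hr i]
      exact Finset.single_le_sum (f := fun i' => Z (i, i')) (by simp) (Finset.mem_univ i')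

/-- All parts are powers of `p`. -/
def PB (p : ℕ) (B : Multiset ℕ) : Prop := ∀ j ∈ B, ∃ n : ℕ, j = p ^ n

/-- The permutation character restricted to `p`-power cycle types. -/
def hfun (p : ℕ) (A : Multiset ℕ) : Multiset ℕ → ℚ := fun B => if PB p B then (Mcount A B : ℚ) else 0

/-- Convolution with `hfun p E`. -/
def Tconv (p : ℕ) (hp : p.Prime) (E : Multiset ℕ) :
    (Multiset ℕ → ℚ) →ₗ[Zploc p hp] (Multiset ℕ → ℚ) where
  toFun G := fun B => (B.antidiagonal.map (fun x => G x.1 * hfun p E x.2)).sum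
  map_add' G H := by
    funext B
    simp [add_mul, Multiset.sum_map_add]
  map_smul' c G := by
    funext B
    simp only [Pi.smul_apply, RingHom.id_apply, Subring.smul_def, smul_eq_mul, mul_assoc]
    rw [Multiset.sum_map_mul_left]

theorem Tconv_hfun (p : ℕ) (hp : p.Prime) (A E : Multiset ℕ) :
    Tconv p hp E (hfun p A) = hfun p (A + E) := by
  funext B
  change (B.antidiagonal.map (fun x => hfun p A x.1 * hfun p E x.2)).sum = _
  by_cases hB : PB p B
  · rw [hfun, if_pos hB, Mcount_add_left]
    rw [← Nat.coe_castAddMonoidHom, map_multiset_sum, Multiset.map_map]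
    congr 1
    refine Multiset.map_congr rfl fun x hx => ?_
    rw [Multiset.mem_antidiagonal] at hx
    have h1 : PB p x.1 := fun j hj => hB j (by rw [← hx]; exact Multiset.mem_add.2 (Or.inl hj))
    have h2 : PB p x.2 := fun j hj => hB j (by rw [← hx]; exact Multiset.mem_add.2 (Or.inr hj))
    simp [hfun, h1, h2]
  · rw [hfun, if_neg hB]
    refine Multiset.sum_eq_zero fun y hy => ?_
    rw [Multiset.mem_map] at hy
    obtain ⟨x, hx, rfl⟩ := hy
    rw [Multiset.mem_antidiagonal] at hx
    by_contra hne
    apply hB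
    have h1 : PB p x.1 := by
      by_contra h; exact hne (by simp [hfun, h])
    have h2 : PB p x.2 := by
      by_contra h; exact hne (by simp [hfun, h])
    intro j hj
    rw [← hx, Multiset.mem_add] at hj
    exact hj.elim (h1 j) (h2 j)

theorem hfun_congr_add (p : ℕ) (hp : p.Prime) {A A' : Multiset ℕ} (E : Multiset ℕ)
    (h : hfun p A = hfun p A') : hfun p (A + E) = hfun p (A' + E) := by
  rw [← Tconv_hfun p hp, ← Tconv_hfun p hp, h]

theorem Mcount_singleton (n : ℕ) (B : Multiset ℕ) :
    Mcount {n} B = if B.sum = n then 1 else 0 := by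
  rw [Mcount_eq_Cnt (fun _ : Unit => n) (fam B) {n} B rfl (fam_map B), Cnt_eq_card]
  have e : ∀ f : B.ToType → Unit, wt (fam B) f = (fun _ => n) ↔ B.sum = n := by
    intro f
    have := sum_wt (fam B) f
    have e1 : ∑ x, fam B x = B.sum := by
      conv_rhs => rw [← fam_map B]
      rfl
    simp only [Finset.univ_unique, Finset.sum_singleton] at this
    rw [funext_iff]
    simp only [PUnit.default_eq_unit] at this
    simp [this, e1]
  simp only [e]
  split_ifs with h <;> simp [h]

theorem Mcount_zero_left (B : Multiset ℕ) : Mcount 0 B = if B = 0 then 1 else 0 := by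
  rw [Mcount_eq_Cnt (fun x : Empty => x.elim) (fam B) 0 B rfl (fam_map B), Cnt_eq_card]
  split_ifs with h
  · subst h
    rw [Finset.card_eq_one]
    refine ⟨fun x => (Multiset.notMem_zero _ (Multiset.coe_mem (x := x))).elim, ?_⟩
    ext f
    simp only [Finset.mem_filter, Finset.mem_univ, true_and, Finset.mem_singleton]
    refine ⟨fun _ => funext fun x => (f x).elim, fun _ => funext fun x => x.elim⟩
  · rw [Finset.card_eq_zero]
    obtain ⟨j, hj⟩ := Multiset.exists_mem_of_ne_zero h
    rw [← fam_map B, Multiset.mem_map] at hj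
    obtain ⟨x, -, -⟩ := hj
    ext f
    exact (f x).elim

theorem hfun_zero_singleton (p : ℕ) (hp : p.Prime) : hfun p {0} = hfun p 0 := by
  funext B
  unfold hfun
  split_ifs with hB
  · rw [Mcount_singleton, Mcount_zero_left]
    congr 2
    rw [eq_iff_iff]
    constructor
    · intro h
      rw [Multiset.sum_eq_zero_iff] at h
      by_contra hne
      obtain ⟨j, hj⟩ := Multiset.exists_mem_of_ne_zero hne
      obtain ⟨k, hk⟩ := hB j hj
      have := h j hj
      have := pow_pos hp.pos k
      omega
    · rintro rfl; simp
  · rfl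

theorem hfun_filter (p : ℕ) (hp : p.Prime) (A : Multiset ℕ) :
    hfun p A = hfun p (A.filter (fun x => x ≠ 0)) := by
  induction A using Multiset.induction with
  | empty => simp
  | cons a A ih =>
    by_cases ha : a = 0
    · subst ha
      rw [Multiset.filter_cons_of_neg _ (by simp), ← ih, ← Multiset.singleton_add]
      rw [hfun_congr_add p hp A (hfun_zero_singleton p hp), zero_add]
    · rw [Multiset.filter_cons_of_pos (p := fun x => x ≠ 0) _ ha, ← Multiset.singleton_add, ← Multiset.singleton_add,
        add_comm, hfun_congr_add p hp _ ih, add_comm]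

theorem Mcount_filter (p : ℕ) (hp : p.Prime) (A B : Multiset ℕ) (hB : PB p B) :
    Mcount A B = Mcount (A.filter (fun x => x ≠ 0)) B := by
  have := congrFun (hfun_filter p hp A) B
  simp only [hfun, hB, if_true] at this
  exact_mod_cast this

theorem choose_pow_mul (p : ℕ) (hp : p.Prime) (m k : ℕ) :
    Nat.choose (p ^ k * m) (p ^ k) ≡ m [MOD p] := by
  have := Fact.mk hp
  induction k with
  | zero => simp; rfl
  | succ k ih =>
    have h := Choose.choose_modEq_choose_mod_mul_choose_div_nat (n := p ^ (k + 1) * m)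
      (k := p ^ (k + 1)) (p := p)
    have e1 : p ^ (k + 1) * m = p * (p ^ k * m) := by ring
    have e2 : p ^ (k + 1) = p * p ^ k := by ring
    rw [e1, e2] at h
    rw [Nat.mul_mod_right, Nat.mul_mod_right, Nat.mul_div_cancel_left _ hp.pos,
      Nat.mul_div_cancel_left _ hp.pos, Nat.choose_self, one_mul] at h
    rw [e1, e2]
    exact h.trans ih

theorem exists_choose (p : ℕ) (hp : p.Prime) (n : ℕ) (hn : n ≠ 0) (h : ∀ k, n ≠ p ^ k) :
    ∃ i, 0 < i ∧ i < n ∧ ¬ p ∣ n.choose i := by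
  obtain ⟨k, m, hm, rfl⟩ := Nat.exists_eq_pow_mul_and_not_dvd hn p hp.ne_one
  have hm1 : m ≠ 1 := fun hm1 => h k (by simp [hm1])
  have hm0 : m ≠ 0 := fun hm0 => hn (by simp [hm0])
  have hk : 0 < p ^ k := pow_pos hp.pos k
  refine ⟨p ^ k, hk, ?_, ?_⟩
  · have : 2 ≤ m := by omega
    nlinarith
  · rw [Nat.dvd_iff_mod_eq_zero] at *
    rw [choose_pow_mul p hp m k]
    exact hm

theorem pow_msum {R : Type*} [CommSemiring R] (x : R) (B : Multiset ℕ) :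
    x ^ B.sum = (B.map (fun b => x ^ b)).prod := by
  induction B using Multiset.induction with
  | empty => simp
  | cons b B ih => simp [pow_add, ih]

theorem Mcount_pair_mod (p : ℕ) (hp : p.Prime) (n i : ℕ) (hi : i ≤ n) (B : Multiset ℕ)
    (hB : PB p B) (hs : B.sum = n) : ((Mcount {i, n - i} B : ℕ) : ZMod p) = (n.choose i : ℕ) := by
  have := Fact.mk hp
  let a : Fin 2 →₀ ℕ := Finsupp.equivFunOnFinite.symm ![i, n - i]
  have ha : Finset.univ.val.map a = {i, n - i} := by rfl
  rw [Mcount_eq_coeff a _ B ha]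
  have h1 : MvPolynomial.map (Nat.castRingHom (ZMod p)) (Phi (Fin 2) B)
      = (MvPolynomial.X 0 + MvPolynomial.X 1) ^ n := by
    unfold Phi
    rw [map_multiset_prod, Multiset.map_map, ← hs, pow_msum]
    congr 1
    refine Multiset.map_congr rfl fun b hb => ?_
    obtain ⟨k, rfl⟩ := hB b hb
    simp only [Function.comp, Fin.sum_univ_two, map_add, map_pow, MvPolynomial.map_X]
    rw [add_pow_char_pow]
  have h2 := congrArg (MvPolynomial.coeff a) h1
  rw [MvPolynomial.coeff_map, MvPolynomial.coeff_add_pow] at h2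
  rw [eq_natCast] at h2
  rw [h2]
  have : (a 0, a 1) ∈ Finset.HasAntidiagonal.antidiagonal n := by
    rw [Finset.HasAntidiagonal.mem_antidiagonal]
    simp [a]; omega
  rw [if_pos this]
  rfl

/-- The span of characters of proper Young subgroups of `S_n`. -/
def Wspan (p : ℕ) (hp : p.Prime) (n : ℕ) : Submodule (Zploc p hp) (Multiset ℕ → ℚ) :=
  Submodule.span _ {F | ∃ Z : Multiset ℕ, (∀ z ∈ Z, z < n) ∧ Z.sum = n ∧ F = hfun p Z}

theorem hfun_mul (p : ℕ) (A A' : Multiset ℕ) :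
    ∃ (S : Finset (A.ToType × A'.ToType → ℕ)),
    hfun p A * hfun p A' = ∑ Z ∈ S, hfun p (Finset.univ.val.map Z) ∧
    ∀ Z ∈ S, (Finset.univ.val.map Z).sum = A.sum ∧
      ∀ z ∈ Finset.univ.val.map Z, ∃ x ∈ A, z ≤ x := by
  obtain ⟨S, hS, h2⟩ := Mcount_mul A A'
  refine ⟨S, ?_, h2⟩
  funext B
  rw [Finset.sum_apply, Pi.mul_apply]
  unfold hfun
  split_ifs with hB
  · rw [← Nat.cast_mul, hS B]
    push_cast
    rfl
  · simp

theorem Wspan_mul (p : ℕ) (hp : p.Prime) (n : ℕ) (F G : Multiset ℕ → ℚ) (hF : F ∈ Wspan p hp n)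
    (hG : G ∈ Wspan p hp n) : F * G ∈ Wspan p hp n := by
  unfold Wspan at hF
  induction hF using Submodule.span_induction with
  | zero => simp
  | add x y _ _ hx hy => rw [add_mul]; exact Submodule.add_mem _ hx hy
  | smul c x _ hx => rw [smul_mul_assoc]; exact Submodule.smul_mem _ _ hx
  | mem F hF =>
    obtain ⟨Z, hZ, hs, rfl⟩ := hF
    unfold Wspan at hG
    induction hG using Submodule.span_induction with
    | zero => simp
    | add x y _ _ hx hy => rw [mul_add]; exact Submodule.add_mem _ hx hy
    | smul c x _ hx => rw [mul_smul_comm]; exact Submodule.smul_mem _ _ hx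
    | mem G hG =>
      obtain ⟨Z', hZ', hs', rfl⟩ := hG
      obtain ⟨S, h1, h2⟩ := hfun_mul p Z Z'
      rw [h1]
      refine Submodule.sum_mem _ fun Y hY => Submodule.subset_span ⟨_, ?_, ?_, rfl⟩
      · intro z hz
        obtain ⟨x, hx, hzx⟩ := (h2 Y hY).2 z hz
        exact lt_of_le_of_lt hzx (hZ x hx)
      · rw [(h2 Y hY).1, hs]

theorem hfun_one_mul (p n : ℕ) (A : Multiset ℕ) (hA : A.sum = n) :
    hfun p {n} * hfun p A = hfun p A := by
  funext B
  rw [Pi.mul_apply]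
  unfold hfun
  split_ifs with hB
  · rw [Mcount_singleton]
    split_ifs with h
    · simp
    · have : Mcount A B = 0 := by
        by_contra hne
        exact h (by rw [← Mcount_sum hne, hA])
      simp [this]
  · simp

theorem Wspan_one_mul (p : ℕ) (hp : p.Prime) (n : ℕ) (F : Multiset ℕ → ℚ) (hF : F ∈ Wspan p hp n) :
    hfun p {n} * F = F := by
  unfold Wspan at hF
  induction hF using Submodule.span_induction with
  | zero => simp
  | add x y _ _ hx hy => rw [mul_add, hx, hy]
  | smul c x _ hx => rw [mul_smul_comm, hx]
  | mem F hF =>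
    obtain ⟨Z, hZ, hs, rfl⟩ := hF
    exact hfun_one_mul p n Z hs

theorem intCast_mem_Zploc (p : ℕ) (hp : p.Prime) (z : ℤ) : (z : ℚ) ∈ Zploc p hp :=
  intCast_mem _ z

theorem natCast_inv_mem_Zploc (p : ℕ) (hp : p.Prime) (z : ℕ) (hz : ¬ p ∣ z) :
    ((z : ℚ))⁻¹ ∈ Zploc p hp :=
  ⟨1, z, by rwa [Int.natCast_dvd_natCast], by simp⟩

theorem prod_expand (p : ℕ) (hp : p.Prime) (n : ℕ) (u : Multiset ℕ → ℚ) (hu : u ∈ Wspan p hp n)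
    (S : Finset ℕ) (hS : S.Nonempty) :
    (∏ v ∈ S, ((v : ℚ) • hfun p {n} - u)) - ((∏ v ∈ S, v : ℕ) : ℚ) • hfun p {n}
      ∈ Wspan p hp n := by
  have hone : hfun p {n} * hfun p {n} = hfun p {n} := hfun_one_mul p n {n} (by simp)
  have key : ∀ (c : ℕ) (F : Multiset ℕ → ℚ), F ∈ Wspan p hp n → (c : ℚ) • F ∈ Wspan p hp n := by
    intro c F hF
    exact Submodule.smul_mem _ (⟨(c : ℚ), natCast_mem _ c⟩ : Zploc p hp) hF
  induction hS using Finset.Nonempty.cons_induction with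
  | singleton v =>
    simpa using hu
  | cons v S hv hS ih =>
    rw [Finset.prod_cons, Finset.prod_cons]
    set Q := ∏ v ∈ S, ((v : ℚ) • hfun p {n} - u)
    set c := ∏ v ∈ S, v
    have e : ((v : ℚ) • hfun p {n} - u) * Q - ((v * c : ℕ) : ℚ) • hfun p {n}
        = (v : ℚ) • (hfun p {n} * (Q - (c : ℚ) • hfun p {n}))
          - (u * (Q - (c : ℚ) • hfun p {n})) - (c : ℚ) • (hfun p {n} * u)
          + ((v : ℚ) * c) • (hfun p {n} * hfun p {n} - hfun p {n}) := by
      funext B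
      simp only [Pi.sub_apply, Pi.mul_apply, Pi.smul_apply, Pi.add_apply, smul_eq_mul]
      push_cast
      ring
    rw [e, hone, sub_self, smul_zero, add_zero, Wspan_one_mul p hp n _ ih,
      Wspan_one_mul p hp n _ hu]
    exact Submodule.sub_mem _ (Submodule.sub_mem _ (key v _ ih) (Wspan_mul p hp n _ _ hu ih))
      (key c _ hu)

theorem Mcount_pair_le (p : ℕ) (hp : p.Prime) (i j : ℕ) (B : Multiset ℕ) (hB : PB p B) :
    Mcount {i, j} B ≤ 2 ^ B.sum := by
  unfold Mcount
  refine (Fintype.card_subtype_le _).trans ?_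
  simp only [Fintype.card_pi, Fintype.card_fin, Finset.prod_const, Finset.card_univ]
  have h1 : Multiset.card ({i, j} : Multiset ℕ) = 2 := by simp
  rw [h1]
  refine Nat.pow_le_pow_right (by norm_num) ?_
  have := Multiset.card_nsmul_le_sum (s := B) (a := 1) ?_
  · simpa using this
  · intro x hx
    obtain ⟨k, rfl⟩ := hB x hx
    exact pow_pos hp.pos k

theorem one_mem_Wspan (p : ℕ) (hp : p.Prime) (n : ℕ) (hn : n ≠ 0) (h : ∀ k, n ≠ p ^ k) :
    hfun p {n} ∈ Wspan p hp n := by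
  obtain ⟨i, hi0, hin, hi⟩ := exists_choose p hp n hn h
  have := Fact.mk hp
  have hu : hfun p {i, n - i} ∈ Wspan p hp n := by
    refine Submodule.subset_span ⟨_, ?_, ?_, rfl⟩
    · intro z hz
      simp at hz
      omega
    · simp; omega
  let S := (Finset.range (2 ^ n + 1)).filter (fun v => ¬ p ∣ v)
  have h1S : 1 ∈ S := by
    simp only [S, Finset.mem_filter, Finset.mem_range]
    exact ⟨by have := Nat.one_le_two_pow (n := n); omega, by simpa using hp.one_lt.ne'⟩
  have := prod_expand p hp n _ hu S ⟨1, h1S⟩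
  have hz : ∏ v ∈ S, ((v : ℚ) • hfun p {n} - hfun p {i, n - i}) = 0 := by
    funext B
    rw [Finset.prod_apply, Pi.zero_apply, Finset.prod_eq_zero_iff]
    by_cases hB : PB p B ∧ B.sum = n
    · refine ⟨Mcount {i, n - i} B, ?_, ?_⟩
      · simp only [S, Finset.mem_filter, Finset.mem_range]
        constructor
        · have := Mcount_pair_le p hp i (n - i) B hB.1
          rw [hB.2] at this
          omega
        · rw [← ZMod.natCast_eq_zero_iff, Mcount_pair_mod p hp n i hin.le B hB.1 hB.2,
            ZMod.natCast_eq_zero_iff]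
          exact hi
      · simp [hfun, hB.1, Mcount_singleton, hB.2]
    · refine ⟨1, h1S, ?_⟩
      by_cases hB1 : PB p B
      · have hs : B.sum ≠ n := fun e => hB ⟨hB1, e⟩
        have : Mcount {i, n - i} B = 0 := by
          by_contra hne
          apply hs
          rw [← Mcount_sum hne]
          simp; omega
        rw [Pi.sub_apply, Pi.smul_apply]
        unfold hfun
        rw [if_pos hB1, if_pos hB1, this, Mcount_singleton]
        simp [hs, Ne.symm hs]
      · simp [hfun, hB1]
  rw [hz, zero_sub, neg_mem_iff] at this
  have hnd : ¬ p ∣ ∏ v ∈ S, v := by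
    rw [hp.prime.dvd_finsetProd_iff]
    rintro ⟨v, hv, hd⟩
    exact (Finset.mem_filter.1 hv).2 hd
  have h3 := Submodule.smul_mem _ (⟨_, natCast_inv_mem_Zploc p hp _ hnd⟩ : Zploc p hp) this
  rw [Subring.smul_def, smul_smul, inv_mul_cancel₀, one_smul] at h3
  · exact h3
  · intro h0
    apply hnd
    rw [Nat.cast_eq_zero] at h0
    rw [h0]
    exact dvd_zero p

/-- The `ℤ_(p)`-span of the characters labelled by `Pow`. -/
def Pspan (p : ℕ) (hp : p.Prime) : Submodule (Zploc p hp) (Multiset ℕ → ℚ) :=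
  Submodule.span _ {F | ∃ Z : Multiset ℕ, PB p Z ∧ F = hfun p Z}

theorem sum_sq_lt (n : ℕ) (hn : n ≠ 0) (Z : Multiset ℕ) (hZ : ∀ z ∈ Z, z < n) (hs : Z.sum = n) :
    (Z.map (fun z => z ^ 2)).sum < n ^ 2 := by
  have h : (Z.map (fun z => z ^ 2)).sum ≤ (Z.map (fun z => z * (n - 1))).sum := by
    refine Multiset.sum_map_le_sum_map _ _ fun z hz => ?_
    have := hZ z hz
    rw [sq]
    exact Nat.mul_le_mul_left _ (by omega)
  rw [Multiset.sum_map_mul_right, Multiset.map_id', hs] at h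
  have : n * (n - 1) < n ^ 2 := by
    rw [sq]
    exact Nat.mul_lt_mul_of_pos_left (by omega) (by omega)
  omega

theorem hfun_mem_Pspan (p : ℕ) (hp : p.Prime) : ∀ (N : ℕ) (A : Multiset ℕ),
    (A.map (fun z => z ^ 2)).sum = N → hfun p A ∈ Pspan p hp := by
  intro N
  induction N using Nat.strong_induction_on with
  | _ N ih =>
    intro A hA
    by_cases h : ∃ n ∈ A, n ≠ 0 ∧ ∀ k, n ≠ p ^ k
    · obtain ⟨n, hnA, hn0, hn⟩ := h
      obtain ⟨E, rfl⟩ := Multiset.exists_cons_of_mem hnA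
      rw [← Multiset.singleton_add, ← Tconv_hfun p hp]
      have h1 := one_mem_Wspan p hp n hn0 hn
      have h2 : Wspan p hp n ≤ (Pspan p hp).comap (Tconv p hp E) := by
        unfold Wspan
        rw [Submodule.span_le]
        rintro F ⟨Z, hZ, hs, rfl⟩
        rw [SetLike.mem_coe, Submodule.mem_comap, Tconv_hfun]
        refine ih _ ?_ _ rfl
        have := sum_sq_lt n hn0 Z hZ hs
        rw [Multiset.map_cons, Multiset.sum_cons] at hA
        rw [Multiset.map_add, Multiset.sum_add]
        omega
      exact h2 h1
    · rw [hfun_filter p hp]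
      refine Submodule.subset_span ⟨_, ?_, rfl⟩
      intro j hj
      rw [Multiset.mem_filter] at hj
      by_contra hne
      exact h ⟨j, hj.1, hj.2, fun k hk => hne ⟨k, hk⟩⟩

/-- The small parts. -/
def sm (p r : ℕ) (A : Multiset ℕ) : Multiset ℕ := A.filter (fun j => j < p ^ r)

theorem sm_add_large (p r : ℕ) (A : Multiset ℕ) : sm p r A + A.filter (fun j => p ^ r ≤ j) = A := by
  unfold sm
  have := Multiset.filter_add_not (fun j => j < p ^ r) A
  simpa only [not_lt] using this

theorem large_form (p : ℕ) (hp : p.Prime) (r n : ℕ) (h : p ^ r ≤ p ^ n) :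
    p ^ n = p ^ r * p ^ (n - r) := by
  rw [← pow_add]
  congr 1
  have := (Nat.pow_le_pow_iff_right hp.one_lt).1 h
  omega

theorem lamGeq_PB (p : ℕ) (hp : p.Prime) (r : ℕ) (A : Multiset ℕ) (hA : PB p A) :
    PB p (lamGeq p r A) := by
  intro j hj
  unfold lamGeq at hj
  rw [Multiset.mem_map] at hj
  obtain ⟨x, hx, rfl⟩ := hj
  rw [Multiset.mem_filter] at hx
  obtain ⟨n, rfl⟩ := hA x hx.1
  exact ⟨n - r, by rw [large_form p hp r n hx.2, Nat.mul_div_cancel_left _ (pow_pos hp.pos r)]⟩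

theorem lamGeq_mul (p : ℕ) (hp : p.Prime) (r : ℕ) (A : Multiset ℕ) (hA : PB p A) :
    (lamGeq p r A).map (fun x => p ^ r * x) = A.filter (fun j => p ^ r ≤ j) := by
  unfold lamGeq
  rw [Multiset.map_map]
  conv_rhs => rw [← Multiset.map_id (A.filter (fun j => p ^ r ≤ j))]
  refine Multiset.map_congr rfl fun x hx => ?_
  rw [Multiset.mem_filter] at hx
  obtain ⟨n, rfl⟩ := hA x hx.1
  rw [Function.comp, large_form p hp r n hx.2, Nat.mul_div_cancel_left _ (pow_pos hp.pos r), id]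

theorem sm_lamBar (p r : ℕ) (A : Multiset ℕ) : sm p r (lamBar p r A) = sm p r A := by
  unfold sm lamBar
  rw [Multiset.filter_add, Multiset.filter_filter]
  have : (Multiset.replicate ((A.filter (fun j => p ^ r ≤ j)).sum / p ^ r) (p ^ r)).filter
      (fun j => j < p ^ r) = 0 := by
    rw [Multiset.filter_eq_nil]
    intro a ha
    rw [Multiset.eq_of_mem_replicate ha]
    exact lt_irrefl _
  rw [this]
  simp

theorem lamBar_iff (p r w : ℕ) (lam mu : PowP p w) :
    lamBar p r lam.1.parts = lamBar p r mu.1.parts ↔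
      sm p r lam.1.parts = sm p r mu.1.parts := by
  constructor
  · intro h
    rw [← sm_lamBar, h, sm_lamBar]
  · intro h
    have h1 := congrArg Multiset.sum (sm_add_large p r lam.1.parts)
    have h2 := congrArg Multiset.sum (sm_add_large p r mu.1.parts)
    rw [Multiset.sum_add, lam.1.parts_sum] at h1
    rw [Multiset.sum_add, mu.1.parts_sum] at h2
    have h3 : (lam.1.parts.filter (fun j => p ^ r ≤ j)).sum
        = (mu.1.parts.filter (fun j => p ^ r ≤ j)).sum := by
      rw [h] at h1
      omega
    unfold lamBar
    rw [h3]
    unfold sm at h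
    rw [h]

theorem powP_ext (p : ℕ) (hp : p.Prime) (r w : ℕ) (lam mu : PowP p w)
    (h : sm p r lam.1.parts = sm p r mu.1.parts)
    (h' : lamGeq p r lam.1.parts = lamGeq p r mu.1.parts) : lam = mu := by
  apply Subtype.ext
  apply Nat.Partition.ext
  rw [← sm_add_large p r lam.1.parts, ← sm_add_large p r mu.1.parts, ← lamGeq_mul p hp r _ lam.2,
    ← lamGeq_mul p hp r _ mu.2, h, h']

theorem sum_map_mul (c : ℕ) (Z : Multiset ℕ) : (Z.map (fun x => c * x)).sum = c * Z.sum := by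
  rw [Multiset.sum_map_mul_left, Multiset.map_id']

theorem powP_exists (p : ℕ) (hp : p.Prime) (r w : ℕ) (mu : PowP p w) (Z : Multiset ℕ)
    (hZ : PB p Z) (hs : Z.sum = (lamGeq p r mu.1.parts).sum) :
    ∃ nu : PowP p w, sm p r nu.1.parts = sm p r mu.1.parts ∧ lamGeq p r nu.1.parts = Z := by
  have hr : 0 < p ^ r := pow_pos hp.pos r
  have hL : ∀ x ∈ Z.map (fun x => p ^ r * x), p ^ r ≤ x := by
    intro x hx
    rw [Multiset.mem_map] at hx
    obtain ⟨z, hz, rfl⟩ := hx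
    obtain ⟨n, rfl⟩ := hZ z hz
    exact Nat.le_mul_of_pos_right _ (pow_pos hp.pos n)
  have hsm : ∀ x ∈ sm p r mu.1.parts, x < p ^ r := fun x hx => (Multiset.mem_filter.1 hx).2
  have hPB : ∀ j ∈ sm p r mu.1.parts + Z.map (fun x => p ^ r * x), ∃ n : ℕ, j = p ^ n := by
    intro j hj
    rw [Multiset.mem_add] at hj
    rcases hj with hj | hj
    · exact mu.2 j (Multiset.mem_filter.1 hj).1
    · rw [Multiset.mem_map] at hj
      obtain ⟨z, hz, rfl⟩ := hj
      obtain ⟨n, rfl⟩ := hZ z hz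
      exact ⟨r + n, by rw [pow_add]⟩
  refine ⟨⟨⟨sm p r mu.1.parts + Z.map (fun x => p ^ r * x), ?_, ?_⟩, hPB⟩, ?_, ?_⟩
  · intro i hi
    obtain ⟨n, rfl⟩ := hPB i hi
    exact pow_pos hp.pos n
  · rw [Multiset.sum_add, sum_map_mul, hs, ← sum_map_mul, lamGeq_mul p hp r _ mu.2,
      ← Multiset.sum_add, sm_add_large, mu.1.parts_sum]
  · change (sm p r mu.1.parts + Z.map (fun x => p ^ r * x)).filter (fun j => j < p ^ r) = _
    rw [Multiset.filter_add, Multiset.filter_eq_self.2 hsm, Multiset.filter_eq_nil.2, add_zero]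
    intro a ha
    exact not_lt.2 (hL a ha)
  · change lamGeq p r (sm p r mu.1.parts + Z.map (fun x => p ^ r * x)) = _
    unfold lamGeq
    rw [Multiset.filter_add, Multiset.filter_eq_self.2 hL, Multiset.filter_eq_nil.2, zero_add,
      Multiset.map_map]
    · conv_rhs => rw [← Multiset.map_id Z]
      refine Multiset.map_congr rfl fun x _ => ?_
      simp [Nat.mul_div_cancel_left _ hr]
    · intro a ha
      exact not_le.2 (hsm a ha)

theorem Cmat_apply (p r w : ℕ) (lam mu : PowP p w) : Cmat p r w lam mu =
    if lamBar p r lam.1.parts = lamBar p r mu.1.parts then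
      (Mcount (lamGeq p r lam.1.parts) (lamGeq p r mu.1.parts) : ℚ)
    else 0 := rfl

theorem D_lemma (p : ℕ) (hp : p.Prime) (r w : ℕ) (A : Multiset ℕ) :
    ∃ D : PowP p w → ℚ, (∀ nu, D nu ∈ Zploc p hp) ∧ ∀ mu : PowP p w,
      (Mcount A (lamGeq p r mu.1.parts) : ℚ) = ∑ nu, D nu * Cmat p r w nu mu := by
  have h := hfun_mem_Pspan p hp _ A rfl
  suffices H : ∃ D : PowP p w → ℚ, (∀ nu, D nu ∈ Zploc p hp) ∧ ∀ mu : PowP p w,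
      hfun p A (lamGeq p r mu.1.parts) = ∑ nu, D nu * Cmat p r w nu mu by
    obtain ⟨D, h1, h2⟩ := H
    refine ⟨D, h1, fun mu => ?_⟩
    rw [← h2, hfun, if_pos (lamGeq_PB p hp r _ mu.2)]
  generalize hfun p A = F at h
  unfold Pspan at h
  induction h using Submodule.span_induction with
  | zero => exact ⟨0, fun _ => Subring.zero_mem _, fun mu => by simp⟩
  | add x y _ _ hx hy =>
    obtain ⟨D, h1, h2⟩ := hx
    obtain ⟨E, h3, h4⟩ := hy
    refine ⟨D + E, fun nu => Subring.add_mem _ (h1 nu) (h3 nu), fun mu => ?_⟩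
    simp only [Pi.add_apply, h2, h4, add_mul, Finset.sum_add_distrib]
  | smul c x _ hx =>
    obtain ⟨D, h1, h2⟩ := hx
    refine ⟨fun nu => c * D nu, fun nu => Subring.mul_mem _ c.2 (h1 nu), fun mu => ?_⟩
    rw [Pi.smul_apply, h2, Subring.smul_def, smul_eq_mul, Finset.mul_sum]
    simp only [mul_assoc]
  | mem F hF =>
    obtain ⟨Z, hZ, rfl⟩ := hF
    refine ⟨fun nu => if lamGeq p r nu.1.parts = Z then 1 else 0, fun nu => ?_, fun mu => ?_⟩
    · beta_reduce
      split_ifs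
      · exact Subring.one_mem _
      · exact Subring.zero_mem _
    · beta_reduce
      rw [hfun, if_pos (lamGeq_PB p hp r _ mu.2)]
      by_cases hex : ∃ nu : PowP p w, sm p r nu.1.parts = sm p r mu.1.parts ∧
          lamGeq p r nu.1.parts = Z
      · obtain ⟨nu, h1, h2⟩ := hex
        rw [Finset.sum_eq_single nu]
        · rw [if_pos h2, one_mul, Cmat_apply, if_pos ((lamBar_iff p r w _ _).2 h1), h2]
        · intro nu' _ hne
          by_cases h3 : lamGeq p r nu'.1.parts = Z
          · rw [if_pos h3, one_mul, Cmat_apply, if_neg]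
            rw [lamBar_iff]
            intro h4
            exact hne (powP_ext p hp r w _ _ (h4.trans h1.symm) (h3.trans h2.symm))
          · rw [if_neg h3, zero_mul]
        · intro h; exact absurd (Finset.mem_univ _) h
      · have h0 : Mcount Z (lamGeq p r mu.1.parts) = 0 := by
          by_contra hne
          exact hex (powP_exists p hp r w mu Z hZ (Mcount_sum hne))
        rw [h0, Nat.cast_zero, eq_comm]
        refine Finset.sum_eq_zero fun nu _ => ?_
        by_cases h3 : lamGeq p r nu.1.parts = Z
        · rw [if_pos h3, one_mul, Cmat_apply, if_neg]
          rw [lamBar_iff]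
          exact fun h4 => hex ⟨nu, h4, h3⟩
        · rw [if_neg h3, zero_mul]

theorem wt_mul {ι κ : Type} [Fintype κ] (c : ℕ) (b : κ → ℕ) (f : κ → ι) (i : ι) :
    wt (fun j => c * b j) f i = c * wt b f i := by
  unfold wt
  rw [Finset.mul_sum]
  refine Finset.sum_congr rfl fun j _ => ?_
  split_ifs <;> simp

theorem Mcount_scale {ι : Type} [Fintype ι] (c : ℕ) (hc : 0 < c) (s : ι → ℕ) (B : Multiset ℕ) :
    Mcount (Finset.univ.val.map (fun i => c * s i)) (B.map (fun x => c * x))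
      = Mcount (Finset.univ.val.map s) B := by
  rw [Mcount_eq_Cnt (fun i => c * s i) (fun j => c * fam B j) _ _ rfl
    (by conv_rhs => rw [← fam_map B, Multiset.map_map]
        rfl),
    Mcount_eq_Cnt s (fam B) _ _ rfl (fam_map B), Cnt_eq_card, Cnt_eq_card]
  congr 1
  ext f
  simp only [Finset.mem_filter, Finset.mem_univ, true_and, funext_iff, wt_mul]
  exact forall_congr' fun i => Nat.mul_right_inj hc.ne'

theorem Mcount_scale_dvd {ι : Type} [Fintype ι] (c : ℕ) (s : ι → ℕ) (B : Multiset ℕ)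
    (h : Mcount (Finset.univ.val.map s) (B.map (fun x => c * x)) ≠ 0) (i : ι) : c ∣ s i := by
  rw [Mcount_eq_Cnt s (fun j => c * fam B j) _ _ rfl
    (by conv_rhs => rw [← fam_map B, Multiset.map_map]
        rfl), Cnt_eq_card, Finset.card_ne_zero] at h
  obtain ⟨f, hf⟩ := h
  simp only [Finset.mem_filter, Finset.mem_univ, true_and] at hf
  rw [← hf, wt_mul]
  exact dvd_mul_right _ _

theorem wt_inj {ι κ : Type} [Fintype κ] (b : κ → ℕ) (f : κ → ι) (hf : Function.Injective f)
    (j : κ) : wt b f (f j) = b j := by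
  unfold wt
  rw [Finset.sum_eq_single j]
  · simp
  · intro k _ hk
    rw [if_neg (fun h => hk (hf h))]
  · intro h; exact absurd (Finset.mem_univ _) h

theorem wt_surj {ι κ : Type} [Fintype κ] (a : ι → ℕ) (ha : ∀ i, 0 < a i) (b : κ → ℕ) (f : κ → ι)
    (h : wt b f = a) : Function.Surjective f := by
  intro i
  by_contra hne
  push Not at hne
  have h1 := ha i
  rw [← h] at h1
  unfold wt at h1
  rw [Finset.sum_eq_zero (fun j _ => if_neg (hne j))] at h1
  exact lt_irrefl _ h1

theorem fam_pos (A : Multiset ℕ) (hA : ∀ x ∈ A, 0 < x) (i : A.ToType) : 0 < fam A i := by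
  have h : fam A i ∈ Finset.univ.val.map (fam A) :=
    Multiset.mem_map_of_mem _ (Finset.mem_univ i)
  rw [fam_map] at h
  exact hA _ h

theorem Mcount_ne_zero_card {A B : Multiset ℕ} (hA : ∀ x ∈ A, 0 < x) (h : Mcount A B ≠ 0)
    (hc : Multiset.card B ≤ Multiset.card A) : A = B := by
  rw [Mcount_fam, Cnt_eq_card, Finset.card_ne_zero] at h
  obtain ⟨f, hf⟩ := h
  simp only [Finset.mem_filter, Finset.mem_univ, true_and] at hf
  have hs := wt_surj _ (fam_pos A hA) _ _ hf
  have h1 := Fintype.card_le_of_surjective f hs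
  have hb : Function.Bijective f := by
    rw [Fintype.bijective_iff_surjective_and_card]
    refine ⟨hs, le_antisymm ?_ h1⟩
    rw [Multiset.card_coe, Multiset.card_coe]
    exact hc
  let e : B.ToType ≃ A.ToType := Equiv.ofBijective f hb
  have h2 : ∀ j, fam A (e j) = fam B j := fun j => by
    rw [← hf]
    exact wt_inj _ _ hb.1 j
  conv_lhs => rw [← fam_map A]
  conv_rhs => rw [← fam_map B]
  have h3 : (Finset.univ : Finset A.ToType) = Finset.univ.map e.toEmbedding := by simp
  rw [h3, Finset.map_val, Multiset.map_map]
  exact Multiset.map_congr rfl fun j _ => h2 j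

/-- The product of the factorials of the multiplicities. -/
def xprod (A : Multiset ℕ) : ℕ := ∏ v ∈ A.toFinset, (A.count v).factorial

theorem xprod_pos (A : Multiset ℕ) : 0 < xprod A :=
  Finset.prod_pos fun _ _ => Nat.factorial_pos _

theorem card_stab {ι : Type} [Fintype ι] (a : ι → ℕ) :
    Fintype.card {g : Equiv.Perm ι // a ∘ g = a} = xprod (Finset.univ.val.map a) := by
  rw [DomMulAct.stabilizer_card', xprod]
  have : (Finset.univ.val.map a).toFinset = Finset.univ.image a := rfl
  rw [this]
  refine Finset.prod_congr rfl fun v _ => ?_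
  rw [count_map_univ]

theorem wt_comp {ι κ : Type} [Fintype κ] (b : κ → ℕ) (f : κ → ι) (g : Equiv.Perm ι) (i : ι) :
    wt b (g ∘ f) i = wt b f (g.symm i) := by
  unfold wt
  refine Finset.sum_congr rfl fun j _ => ?_
  simp only [Function.comp, Equiv.eq_symm_apply]

theorem wt_comp' {ι κ : Type} [Fintype κ] (b : κ → ℕ) (f : κ → ι) (g : Equiv.Perm κ) :
    wt b (f ∘ g) = wt (b ∘ g.symm) f := by
  funext i
  unfold wt
  rw [← Equiv.sum_comp g (fun j => if f j = i then (b ∘ g.symm) j else 0)]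
  simp

theorem Mcount_self (A : Multiset ℕ) (hA : ∀ x ∈ A, 0 < x) : Mcount A A = xprod A := by
  conv_rhs => rw [← fam_map A, ← card_stab]
  rw [Mcount_fam, Cnt_eq_card, ← Fintype.card_subtype]
  symm
  have key : ∀ g : Equiv.Perm A.ToType, fam A ∘ g = fam A ↔ wt (fam A) g = fam A := by
    intro g
    constructor
    · intro h
      funext i
      obtain ⟨j, rfl⟩ := g.surjective i
      rw [wt_inj _ _ g.injective, ← Function.comp_apply (f := fam A), h]
    · intro h
      funext j
      rw [Function.comp_apply, ← congrFun h (g j), wt_inj _ _ g.injective]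
  refine Fintype.card_congr (Equiv.ofBijective
    (fun g : {g : Equiv.Perm A.ToType // fam A ∘ g = fam A} =>
      (⟨g.1, (key g.1).1 g.2⟩ : {f : A.ToType → A.ToType // wt (fam A) f = fam A})) ⟨?_, ?_⟩)
  · intro g g' h
    apply Subtype.ext
    apply Equiv.ext
    intro x
    exact congrFun (congrArg Subtype.val h) x
  · rintro ⟨f, hf⟩
    have hs := wt_surj _ (fam_pos A hA) _ _ hf
    have hb : Function.Bijective f := hs.bijective_of_finite
    exact ⟨⟨Equiv.ofBijective f hb, (key _).2 hf⟩, Subtype.ext rfl⟩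

theorem lamGeq_pos (p : ℕ) (hp : p.Prime) {A : Multiset ℕ} (hA : PB p A) : ∀ x ∈ A, 0 < x := by
  intro x hx
  obtain ⟨n, rfl⟩ := hA x hx
  exact pow_pos hp.pos n

theorem Cmat_isUnit (p : ℕ) (hp : p.Prime) (r w : ℕ) : IsUnit (Cmat p r w).det := by
  rw [isUnit_iff_ne_zero]
  intro h0
  obtain ⟨v, hv, hCv⟩ := Matrix.exists_mulVec_eq_zero_iff.2 h0
  have hne : (Finset.univ.filter (fun l : PowP p w => v l ≠ 0)).Nonempty := by
    obtain ⟨l, hl⟩ := Function.ne_iff.1 hv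
    exact ⟨l, by simpa using hl⟩
  obtain ⟨l, hl, hmax⟩ := Finset.exists_max_image _
    (fun l : PowP p w => Multiset.card (lamGeq p r l.1.parts)) hne
  have hl' : v l ≠ 0 := (Finset.mem_filter.1 hl).2
  have h1 := congrFun hCv l
  rw [Matrix.mulVec, dotProduct, Finset.sum_eq_single l] at h1
  · rw [Pi.zero_apply, mul_eq_zero, Cmat_apply, if_pos rfl,
      Mcount_self _ (lamGeq_pos p hp (lamGeq_PB p hp r _ l.2)), Nat.cast_eq_zero] at h1
    rcases h1 with h1 | h1
    · exact (xprod_pos _).ne' h1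
    · exact hl' h1
  · intro m _ hm
    by_contra hne2
    rw [mul_eq_zero, not_or, Cmat_apply] at hne2
    obtain ⟨hc, hvm⟩ := hne2
    by_cases hb : lamBar p r l.1.parts = lamBar p r m.1.parts
    · rw [if_pos hb, Nat.cast_eq_zero] at hc
      have := Mcount_ne_zero_card (lamGeq_pos p hp (lamGeq_PB p hp r _ l.2)) hc
        (hmax m (by simpa using hvm))
      exact hm (powP_ext p hp r w _ _ ((lamBar_iff p r w _ _).1 hb) this).symm
    · exact hc (if_neg hb)
  · intro h; exact absurd (Finset.mem_univ _) h

theorem dvd_card_of_orbits {G X : Type} [Group G] [Fintype G] [MulAction G X] [Fintype X] (d : ℕ)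
    (h : ∀ x : X, d ∣ Nat.card G / Nat.card (MulAction.stabilizer G x)) :
    d ∣ Fintype.card X := by
  rw [MulAction.card_eq_sum_card_group_div_card_stabilizer G X]
  refine Finset.dvd_sum fun x _ => ?_
  simp only [← Nat.card_eq_fintype_card]
  exact h _

/-- The group of symmetries of a family. -/
def symG {ι T : Type} (a : ι → T) : Subgroup (Equiv.Perm ι) where
  carrier := {g | a ∘ g = a}
  one_mem' := rfl
  mul_mem' := by
    intro g h hg hh
    funext i
    have h1 := congrFun hg (h i)
    have h2 := congrFun hh i
    simp only [Function.comp, Equiv.Perm.mul_apply] at *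
    rw [h1, h2]
  inv_mem' := by
    intro g hg
    funext i
    have h1 := congrFun hg (g⁻¹ i)
    simp only [Function.comp, Equiv.Perm.mul_apply] at *
    rw [← h1, ← Equiv.Perm.mul_apply, mul_inv_cancel, Equiv.Perm.one_apply]

theorem xprod_dvd_Mcount (A B : Multiset ℕ) (hA : ∀ x ∈ A, 0 < x) : xprod A ∣ Mcount A B := by
  rw [Mcount_fam, Cnt_eq_card, ← Fintype.card_subtype]
  let _ : MulAction (symG (fam A)) {f : B.ToType → A.ToType // wt (fam B) f = fam A} :=
    { smul := fun g f => ⟨g.1 ∘ f.1, by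
        funext i
        rw [wt_comp, f.2]
        have h1 := congrFun g.2 (g.1.symm i)
        simp only [Function.comp, Equiv.apply_symm_apply] at h1
        exact h1.symm⟩
      one_smul := fun f => rfl
      mul_smul := fun g h f => rfl }
  refine dvd_card_of_orbits (G := symG (fam A)) _ fun f => ?_
  have h1 : Nat.card (MulAction.stabilizer (symG (fam A)) f) = 1 := by
    rw [Nat.card_eq_fintype_card]
    rw [Fintype.card_eq_one_iff]
    refine ⟨1, fun g => ?_⟩
    apply Subtype.ext
    apply Subtype.ext
    apply Equiv.ext
    intro i
    have hs := wt_surj _ (fam_pos A hA) _ _ f.2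
    obtain ⟨j, rfl⟩ := hs i
    exact congrFun (congrArg Subtype.val (MulAction.mem_stabilizer_iff.1 g.2)) j
  rw [h1, Nat.div_one]
  conv_lhs => rw [← fam_map A, ← card_stab, ← Nat.card_eq_fintype_card]
  apply dvd_of_eq
  exact Nat.card_congr (Equiv.subtypeEquivRight fun g => Iff.rfl)

theorem xprod_dvd_Mcount_add (A E B : Multiset ℕ) (hA : ∀ x ∈ A, 0 < x) :
    xprod A ∣ Mcount (A + E) B := by
  rw [Mcount_add_left]
  refine Multiset.dvd_sum fun x hx => ?_
  rw [Multiset.mem_map] at hx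
  obtain ⟨y, _, rfl⟩ := hx
  exact Dvd.dvd.mul_right (xprod_dvd_Mcount A _ hA) _

/-- The weight `r - t` of a part `p ^ t`. -/
def gv (p r v : ℕ) : ℕ := r - Nat.log p v

theorem padicVal_prod (p : ℕ) (hp : p.Prime) {α : Type} (s : Finset α) (f : α → ℕ)
    (hf : ∀ i ∈ s, f i ≠ 0) : padicValNat p (∏ i ∈ s, f i) = ∑ i ∈ s, padicValNat p (f i) := by
  have := Fact.mk hp
  induction s using Finset.induction_on with
  | empty => simp
  | insert a s ha ih =>
    rw [Finset.prod_insert ha, Finset.sum_insert ha, padicValNat.mul, ih]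
    · exact fun i hi => hf i (Finset.mem_insert_of_mem hi)
    · exact hf a (Finset.mem_insert_self _ _)
    · exact Finset.prod_ne_zero_iff.2 fun i hi => hf i (Finset.mem_insert_of_mem hi)

theorem val_xprod (p : ℕ) (hp : p.Prime) (J : Multiset ℕ) (hJ : J ≠ 0) :
    padicValNat p (xprod J) + 1 ≤ Multiset.card J := by
  have := Fact.mk hp
  unfold xprod
  rw [padicVal_prod p hp _ _ (fun _ _ => Nat.factorial_ne_zero _), ← Multiset.toFinset_sum_count_eq]
  apply Nat.succ_le_of_lt
  refine Finset.sum_lt_sum_of_nonempty ?_ ?_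
  · obtain ⟨x, hx⟩ := Multiset.exists_mem_of_ne_zero hJ
    exact ⟨x, Multiset.mem_toFinset.2 hx⟩
  · intro v hv
    rw [Multiset.mem_toFinset] at hv
    exact padicValNat_factorial_lt_of_ne_zero p (Multiset.count_ne_zero.2 hv)

theorem card_mul_le (J : Multiset ℕ) (g : ℕ → ℕ) (c : ℕ) (h : ∀ x ∈ J, c ≤ g x) :
    Multiset.card J * c ≤ (J.map g).sum := by
  have := Multiset.card_nsmul_le_sum (s := J.map g) (a := c) (by
    intro x hx
    rw [Multiset.mem_map] at hx
    obtain ⟨y, hy, rfl⟩ := hx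
    exact h y hy)
  simpa using this

theorem slot_large (p : ℕ) (hp : p.Prime) (r : ℕ) (J : Multiset ℕ)
    (hJ : ∀ x ∈ J, ∃ l < r, x = p ^ l) (hJ0 : J ≠ 0) :
    padicValNat p (xprod J) + 1 ≤ (J.map (gv p r)).sum := by
  have h1 := val_xprod p hp J hJ0
  have h2 := card_mul_le J (gv p r) 1 (by
    intro x hx
    obtain ⟨l, hl, rfl⟩ := hJ x hx
    rw [gv, Nat.log_pow hp.one_lt]
    omega)
  omega

theorem slot_small (p : ℕ) (hp : p.Prime) (r : ℕ) (J : Multiset ℕ)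
    (hJ : ∀ x ∈ J, ∃ l < r, x = p ^ l) (t : ℕ) (ht : t < r) (hs : J.sum = p ^ t)
    (hne : J ≠ {p ^ t}) :
    padicValNat p (xprod J) + gv p r (p ^ t) + 1 ≤ (J.map (gv p r)).sum := by
  have hJ0 : J ≠ 0 := by
    rintro rfl
    have := pow_pos hp.pos t
    simp at hs
    omega
  have h1 := val_xprod p hp J hJ0
  have h2 := card_mul_le J (gv p r) (r - t + 1) (by
    intro x hx
    obtain ⟨l, hl, rfl⟩ := hJ x hx
    rw [gv, Nat.log_pow hp.one_lt]
    have hle : p ^ l ≤ p ^ t := by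
      rw [← hs]
      exact Multiset.single_le_sum (fun _ _ => Nat.zero_le _) _ hx
    have hlt : l ≤ t := (Nat.pow_le_pow_iff_right hp.one_lt).1 hle
    rcases hlt.eq_or_lt with h | h
    · subst h
      exfalso
      apply hne
      obtain ⟨E, rfl⟩ := Multiset.exists_cons_of_mem hx
      rw [Multiset.sum_cons] at hs
      have hE : E = 0 := by
        by_contra hE
        obtain ⟨y, hy⟩ := Multiset.exists_mem_of_ne_zero hE
        have h3 := Multiset.single_le_sum (fun _ _ => Nat.zero_le _) _ hy
        obtain ⟨k, hk, rfl⟩ := hJ y (Multiset.mem_cons_of_mem hy)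
        have := pow_pos hp.pos k
        omega
      rw [hE]
      rfl
    · omega)
  have hc : 0 < Multiset.card J := Multiset.card_pos.2 hJ0
  rw [gv, Nat.log_pow hp.one_lt]
  rw [mul_add, mul_one] at h2
  have h3 : r - t ≤ Multiset.card J * (r - t) := Nat.le_mul_of_pos_left _ hc
  omega

theorem sum_singles {κ : Type} (b : κ → ℕ) (S : Multiset κ) :
    (S.map (fun j => ({b j} : Multiset ℕ))).sum = S.map b := by
  have := Multiset.sum_map_singleton (S.map b)
  rw [Multiset.map_map] at this
  exact this

/-- The multiset of items in a fibre. -/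
def fib {ι κ : Type} [Fintype κ] (b : κ → ℕ) (f : κ → ι) (i : ι) : Multiset ℕ :=
  ∑ j ∈ Finset.univ.filter (fun j => f j = i), ({b j} : Multiset ℕ)

theorem sum_fib {ι κ : Type} [Fintype ι] [Fintype κ] (b : κ → ℕ) (f : κ → ι) :
    ∑ i, fib b f i = Finset.univ.val.map b := by
  refine (Finset.sum_fiberwise Finset.univ f (fun j => ({b j} : Multiset ℕ))).trans ?_
  change (Finset.univ.val.map (fun j => ({b j} : Multiset ℕ))).sum = _
  rw [sum_singles]

theorem fib_eq {ι κ : Type} [Fintype κ] (b : κ → ℕ) (f : κ → ι) (i : ι) :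
    fib b f i = (Finset.univ.filter (fun j => f j = i)).val.map b := by
  unfold fib
  change ((Finset.univ.filter (fun j => f j = i)).val.map (fun j => ({b j} : Multiset ℕ))).sum = _
  rw [sum_singles]

theorem fib_sum {ι κ : Type} [Fintype κ] (b : κ → ℕ) (f : κ → ι) (i : ι) :
    (fib b f i).sum = wt b f i := by
  rw [fib_eq]
  unfold wt
  rw [← Finset.sum_filter]
  rfl

theorem stab_val (p : ℕ) (hp : p.Prime) (r : ℕ) {ι κ : Type} [Fintype ι] [Fintype κ]
    (a : ι → ℕ) (b : κ → ℕ) (f : κ → ι) (ha : ∀ i, ∃ t, a i = p ^ t)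
    (hb : ∀ j, ∃ l < r, b j = p ^ l) (hs : ∀ i, a i < p ^ r → wt b f i = a i)
    (hne : sm p r (Finset.univ.val.map a) ≠ Finset.univ.val.map b) :
    ∑ i, padicValNat p (xprod (fib b f i)) + ∑ i, gv p r (a i) + 1 ≤ ∑ j, gv p r (b j) := by
  have hR : ∑ j, gv p r (b j) = ∑ i, ((fib b f i).map (gv p r)).sum := by
    rw [← Finset.sum_fiberwise Finset.univ f]
    refine Finset.sum_congr rfl fun i _ => ?_
    rw [fib_eq, Multiset.map_map]
    rfl
  have hmem : ∀ i, ∀ x ∈ fib b f i, ∃ l < r, x = p ^ l := by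
    intro i x hx
    rw [fib_eq, Multiset.mem_map] at hx
    obtain ⟨j, _, rfl⟩ := hx
    exact hb j
  rw [hR, ← Finset.sum_add_distrib]
  apply Nat.succ_le_of_lt
  -- the fibre of each slot
  have hle : ∀ i, fib b f i ≠ (if a i < p ^ r then {a i} else 0) →
      padicValNat p (xprod (fib b f i)) + gv p r (a i) < ((fib b f i).map (gv p r)).sum := by
    intro i hi
    obtain ⟨t, ht⟩ := ha i
    split_ifs at hi with hlt
    · have h1 := hs i hlt
      rw [ht] at hlt hi h1 ⊢
      exact Nat.lt_of_succ_le (slot_small p hp r _ (hmem i) t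
        ((Nat.pow_lt_pow_iff_right hp.one_lt).1 hlt) (by rw [fib_sum, h1]) hi)
    · have h1 := slot_large p hp r _ (hmem i) hi
      rw [ht] at hlt ⊢
      have h2 : r ≤ t := (Nat.pow_le_pow_iff_right hp.one_lt).1 (not_lt.1 hlt)
      have h3 : gv p r (p ^ t) = 0 := by
        rw [gv, Nat.log_pow hp.one_lt]; omega
      omega
  have heq : ∀ i, fib b f i = (if a i < p ^ r then {a i} else 0) →
      padicValNat p (xprod (fib b f i)) + gv p r (a i) ≤ ((fib b f i).map (gv p r)).sum := by
    intro i hi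
    rw [hi]
    split_ifs with hlt
    · simp [xprod]
    · obtain ⟨t, ht⟩ := ha i
      rw [ht] at hlt ⊢
      have h2 : r ≤ t := (Nat.pow_le_pow_iff_right hp.one_lt).1 (not_lt.1 hlt)
      have h3 : gv p r (p ^ t) = 0 := by
        rw [gv, Nat.log_pow hp.one_lt]; omega
      simp [xprod, h3]
  refine Finset.sum_lt_sum (fun i _ => ?_) ?_
  · by_cases h : fib b f i = (if a i < p ^ r then {a i} else 0)
    · exact heq i h
    · exact (hle i h).le
  · by_contra hcon
    push Not at hcon
    apply hne
    rw [← sum_fib b f]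
    have h : ∀ i ∈ Finset.univ, fib b f i = (if a i < p ^ r then {a i} else 0) := by
      intro i hi
      by_contra h
      exact absurd (hle i h) (not_lt.2 (hcon i hi))
    rw [Finset.sum_congr rfl h, sm, ← Finset.sum_filter, Multiset.filter_map]
    change _ = ((Finset.univ.filter (fun i => a i < p ^ r)).val.map
      (fun i => ({a i} : Multiset ℕ))).sum
    rw [sum_singles]
    rfl

theorem card_stab2 {ι κ : Type} [Fintype ι] [Fintype κ] (b : κ → ℕ) (f : κ → ι) :
    Nat.card {g : Equiv.Perm κ // (fun j => (b j, f j)) ∘ g = fun j => (b j, f j)}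
      = ∏ i, xprod (fib b f i) := by
  rw [Nat.card_eq_fintype_card, DomMulAct.stabilizer_card']
  have h1 : Finset.univ.image (fun j => (b j, f j)) ⊆ (Finset.univ.image b) ×ˢ Finset.univ := by
    intro y hy
    rw [Finset.mem_image] at hy
    obtain ⟨j, _, rfl⟩ := hy
    simp
  rw [Finset.prod_subset h1, Finset.prod_product_right]
  · refine Finset.prod_congr rfl fun i _ => ?_
    unfold xprod
    symm
    have h2 : (fib b f i).toFinset ⊆ Finset.univ.image b := by
      intro v hv
      rw [Multiset.mem_toFinset, fib_eq, Multiset.mem_map] at hv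
      obtain ⟨j, _, rfl⟩ := hv
      simp
    rw [Finset.prod_subset h2]
    · refine Finset.prod_congr rfl fun v _ => ?_
      congr 1
      rw [fib_eq, Multiset.count_map, Fintype.card_subtype, ← Finset.filter_val, Finset.filter_filter]
      change Finset.card _ = _
      congr 1
      ext j
      simp only [Finset.mem_filter, Finset.mem_univ, true_and, Prod.mk.injEq]
      tauto
    · intro v _ hv
      rw [Multiset.mem_toFinset] at hv
      rw [Multiset.count_eq_zero_of_notMem hv]
      rfl
  · intro y _ hy
    have : Fintype.card {j // (b j, f j) = y} = 0 := by
      rw [Fintype.card_eq_zero_iff]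
      refine ⟨fun j => hy ?_⟩
      rw [Finset.mem_image]
      exact ⟨j.1, Finset.mem_univ _, j.2⟩
    rw [this]
    rfl

theorem count_val (p : ℕ) (hp : p.Prime) (r : ℕ) {ι : Type} [Fintype ι]
    (a s : ι → ℕ) (B : Multiset ℕ) (ha : ∀ i, ∃ t, a i = p ^ t)
    (hb : ∀ x ∈ B, ∃ l < r, x = p ^ l) (hs : ∀ i, a i < p ^ r → s i = a i)
    (hne : sm p r (Finset.univ.val.map a) ≠ B) :
    p ^ (padicValNat p (xprod B) + ∑ i, gv p r (a i) + 1 - (B.map (gv p r)).sum)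
      ∣ Mcount (Finset.univ.val.map s) B := by
  have := Fact.mk hp
  rw [Mcount_eq_Cnt s (fam B) _ _ rfl (fam_map B), Cnt_eq_card, ← Fintype.card_subtype]
  have hb' : ∀ j, ∃ l < r, fam B j = p ^ l := by
    intro j
    apply hb
    have h : fam B j ∈ Finset.univ.val.map (fam B) :=
      Multiset.mem_map_of_mem _ (Finset.mem_univ j)
    rw [fam_map] at h
    exact h
  have hBsum : ∑ j, gv p r (fam B j) = (B.map (gv p r)).sum := by
    conv_rhs => rw [← fam_map B, Multiset.map_map]
    rfl
  let _ : MulAction (symG (fam B)) {f : B.ToType → ι // wt (fam B) f = s} :=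
    { smul := fun g f => ⟨f.1 ∘ (g⁻¹).1, by
        rw [wt_comp']
        have h1 : fam B ∘ (g⁻¹).1.symm = fam B := g.2
        rw [h1]
        exact f.2⟩
      one_smul := fun f => rfl
      mul_smul := fun g h f => by
        apply Subtype.ext
        change f.1 ∘ ((g * h)⁻¹).1 = (f.1 ∘ (h⁻¹).1) ∘ (g⁻¹).1
        rw [mul_inv_rev]
        rfl }
  refine dvd_card_of_orbits (G := symG (fam B)) _ fun f => ?_
  have hG : Nat.card (symG (fam B)) = xprod B := by
    conv_rhs => rw [← fam_map B, ← card_stab, ← Nat.card_eq_fintype_card]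
    exact Nat.card_congr (Equiv.subtypeEquivRight fun g => Iff.rfl)
  have hS : Nat.card (MulAction.stabilizer (symG (fam B)) f)
      = ∏ i, xprod (fib (fam B) f.1 i) := by
    rw [← card_stab2]
    have hst : ∀ g : symG (fam B), g ∈ MulAction.stabilizer (symG (fam B)) f ↔ f.1 ∘ g.1 = f.1 := by
      intro g
      rw [MulAction.mem_stabilizer_iff, ← inv_smul_eq_iff.trans eq_comm, Subtype.ext_iff]
      change f.1 ∘ ((g⁻¹)⁻¹).1 = f.1 ↔ _
      rw [inv_inv]
    refine Nat.card_congr (Equiv.ofBijective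
      (fun g : MulAction.stabilizer (symG (fam B)) f =>
        (⟨g.1.1, by
          have h1 := (hst g.1).1 g.2
          have h2 : fam B ∘ g.1.1 = fam B := g.1.2
          funext j
          exact Prod.ext (congrFun h2 j) (congrFun h1 j)⟩ : {g : Equiv.Perm B.ToType //
          (fun j => (fam B j, f.1 j)) ∘ g = fun j => (fam B j, f.1 j)})) ⟨?_, ?_⟩)
    · intro g g' h
      apply Subtype.ext
      apply Subtype.ext
      have h2 := Subtype.ext_iff.1 h
      exact h2
    · rintro ⟨g, hg⟩
      have h1 : fam B ∘ g = fam B := funext fun j => congrArg Prod.fst (congrFun hg j)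
      have h2 : f.1 ∘ g = f.1 := funext fun j => congrArg Prod.snd (congrFun hg j)
      exact ⟨⟨⟨g, h1⟩, (hst _).2 h2⟩, rfl⟩
  have hdvd : Nat.card (MulAction.stabilizer (symG (fam B)) f) ∣ Nat.card (symG (fam B)) :=
    Subgroup.card_subgroup_dvd_card _
  obtain ⟨q, hq⟩ := hdvd
  have hpos : 0 < Nat.card (MulAction.stabilizer (symG (fam B)) f) := Nat.card_pos
  have hposG : 0 < Nat.card (symG (fam B)) := Nat.card_pos
  rw [hq, Nat.mul_div_cancel_left _ hpos]
  have hq0 : q ≠ 0 := by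
    rintro rfl
    omega
  rw [padicValNat_dvd_iff_le hq0]
  have hv := congrArg (padicValNat p) hq
  rw [padicValNat.mul hpos.ne' hq0, hG, hS,
    padicVal_prod p hp _ _ (fun _ _ => (xprod_pos _).ne')] at hv
  have := stab_val p hp r a (fam B) f.1 ha hb' (fun i hi => by rw [f.2, hs i hi])
    (by rw [fam_map]; exact hne)
  rw [hBsum] at this
  omega

theorem sm_toFinset (p r : ℕ) (A : Multiset ℕ) (hA : PB p A) (hp : p.Prime) :
    (sm p r A).toFinset ⊆ (Finset.range r).image (fun i => p ^ i) := by
  intro v hv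
  rw [Multiset.mem_toFinset, sm, Multiset.mem_filter] at hv
  obtain ⟨n, rfl⟩ := hA v hv.1
  rw [Finset.mem_image]
  exact ⟨n, Finset.mem_range.2 ((Nat.pow_lt_pow_iff_right hp.one_lt).1 hv.2), rfl⟩

theorem sm_count (p r : ℕ) (A : Multiset ℕ) (hp : p.Prime) (i : ℕ) (hi : i ∈ Finset.range r) :
    (sm p r A).count (p ^ i) = A.count (p ^ i) := by
  rw [sm, Multiset.count_filter_of_pos]
  exact (Nat.pow_lt_pow_iff_right hp.one_lt).2 (Finset.mem_range.1 hi)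

theorem xprod_sm (p : ℕ) (hp : p.Prime) (r : ℕ) (A : Multiset ℕ) (hA : PB p A) :
    ∏ i ∈ Finset.range r, (A.count (p ^ i)).factorial = xprod (sm p r A) := by
  rw [xprod, Finset.prod_subset (sm_toFinset p r A hA hp), Finset.prod_image]
  · exact Finset.prod_congr rfl fun i hi => by rw [sm_count p r A hp i hi]
  · intro i _ j _ h
    exact Nat.pow_right_injective hp.two_le h
  · intro v _ hv
    rw [Multiset.mem_toFinset] at hv
    rw [Multiset.count_eq_zero_of_notMem hv]
    rfl

theorem eVal_eq (p : ℕ) (hp : p.Prime) (r : ℕ) (A : Multiset ℕ) (hA : PB p A) :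
    eVal p r A = padicValNat p (xprod (sm p r A)) := by
  rw [← xprod_sm p hp r A hA, padicVal_prod p hp _ _ (fun _ _ => Nat.factorial_ne_zero _)]
  rfl

theorem fVal_eq (p : ℕ) (hp : p.Prime) (r : ℕ) (A : Multiset ℕ) (hA : PB p A) :
    fVal p r A = ((sm p r A).map (gv p r)).sum := by
  rw [Finset.sum_multiset_map_count, Finset.sum_subset (sm_toFinset p r A hA hp), Finset.sum_image]
  · refine Finset.sum_congr rfl fun i hi => ?_
    rw [sm_count p r A hp i hi, gv, Nat.log_pow hp.one_lt, smul_eq_mul, mul_comm]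
  · intro i _ j _ h
    exact Nat.pow_right_injective hp.two_le h
  · intro v _ hv
    rw [Multiset.mem_toFinset] at hv
    rw [Multiset.count_eq_zero_of_notMem hv, zero_smul]

theorem gv_sum (p : ℕ) (hp : p.Prime) (r : ℕ) (A : Multiset ℕ) (hA : PB p A) :
    (A.map (gv p r)).sum = fVal p r A := by
  rw [fVal_eq p hp r A hA]
  conv_lhs => rw [← sm_add_large p r A]
  rw [Multiset.map_add, Multiset.sum_add]
  have : ((A.filter (fun j => p ^ r ≤ j)).map (gv p r)).sum = 0 := by
    refine Multiset.sum_eq_zero fun x hx => ?_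
    rw [Multiset.mem_map] at hx
    obtain ⟨y, hy, rfl⟩ := hx
    rw [Multiset.mem_filter] at hy
    obtain ⟨n, rfl⟩ := hA y hy.1
    have := (Nat.pow_le_pow_iff_right hp.one_lt).1 hy.2
    rw [gv, Nat.log_pow hp.one_lt]
    omega
  rw [this, add_zero]

theorem padicValRat_nonneg_of_mem (p : ℕ) (hp : p.Prime) (q : ℚ) (hq : q ∈ Zploc p hp) :
    0 ≤ padicValRat p q := by
  have := Fact.mk hp
  obtain ⟨a, b, hb, rfl⟩ := hq
  by_cases ha : a = 0
  · simp [ha]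
  have hb0 : b ≠ 0 := by
    rintro rfl
    exact hb (dvd_zero _)
  rw [padicValRat.div (by exact_mod_cast ha) (by exact_mod_cast hb0), padicValRat.of_int,
    padicValRat.of_int, padicValInt.eq_zero_of_not_dvd hb]
  simp

/-- The multiset of parts as a finitely supported family. -/
def fs (A : Multiset ℕ) : A.ToType →₀ ℕ := Finsupp.equivFunOnFinite.symm (fam A)

theorem fs_map (A : Multiset ℕ) : Finset.univ.val.map (fs A) = A := fam_map A

theorem fs_mem (A : Multiset ℕ) (i : A.ToType) : fs A i ∈ A := by
  have h : fs A i ∈ Finset.univ.val.map (fs A) :=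
    Multiset.mem_map_of_mem _ (Finset.mem_univ i)
  rw [fs_map] at h
  exact h

/-- The pairs of families that contribute. -/
def AD (p r : ℕ) (A : Multiset ℕ) : Finset ((A.ToType →₀ ℕ) × (A.ToType →₀ ℕ)) :=
  (Finset.HasAntidiagonal.antidiagonal (fs A)).filter (fun s => ∀ i, p ^ r ∣ s.2 i)

theorem AD_spec (p r : ℕ) (A : Multiset ℕ) (s : (A.ToType →₀ ℕ) × (A.ToType →₀ ℕ))
    (hs : s ∈ AD p r A) (i : A.ToType) (hi : fs A i < p ^ r) : s.2 i = 0 ∧ s.1 i = fs A i := by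
  unfold AD at hs
  rw [Finset.mem_filter, Finset.HasAntidiagonal.mem_antidiagonal] at hs
  have h1 : s.1 i + s.2 i = fs A i := by rw [← hs.1]; rfl
  have h2 : s.2 i = 0 := Nat.eq_zero_of_dvd_of_lt (hs.2 i) (by omega)
  exact ⟨h2, by omega⟩

theorem N_expand (p : ℕ) (hp : p.Prime) (r w : ℕ) (lam mu : PowP p w) :
    Mcount lam.1.parts mu.1.parts = ∑ s ∈ AD p r lam.1.parts,
      Mcount (Finset.univ.val.map s.1) (sm p r mu.1.parts) *
        Mcount (Finset.univ.val.map (fun i => s.2 i / p ^ r)) (lamGeq p r mu.1.parts) := by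
  have h := Mcount_add_right (fs lam.1.parts) (sm p r mu.1.parts)
    (mu.1.parts.filter (fun j => p ^ r ≤ j))
  rw [fs_map, sm_add_large, ← lamGeq_mul p hp r _ mu.2] at h
  rw [h, AD, Finset.sum_filter]
  refine Finset.sum_congr rfl fun s _ => ?_
  split_ifs with hg
  · rw [← Mcount_scale (p ^ r) (pow_pos hp.pos r) (fun i => s.2 i / p ^ r)]
    congr 3
    funext i
    exact (Nat.mul_div_cancel' (hg i)).symm
  · push Not at hg
    obtain ⟨i, hi⟩ := hg
    have : Mcount (Finset.univ.val.map s.2)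
        ((lamGeq p r mu.1.parts).map (fun x => p ^ r * x)) = 0 := by
      by_contra hne
      exact hi (Mcount_scale_dvd _ _ _ hne i)
    rw [this, mul_zero]

theorem N_diag (p : ℕ) (hp : p.Prime) (r w : ℕ) (lam mu : PowP p w)
    (h : sm p r lam.1.parts = sm p r mu.1.parts) :
    Mcount lam.1.parts mu.1.parts = xprod (sm p r lam.1.parts) *
      Mcount (lamGeq p r lam.1.parts) (lamGeq p r mu.1.parts) := by
  have hpos : ∀ i, 0 < fs lam.1.parts i := fun i => lam.1.parts_pos (fs_mem _ i)
  have e := Mcount_add_right (fs lam.1.parts) (sm p r mu.1.parts)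
    (mu.1.parts.filter (fun j => p ^ r ≤ j))
  rw [fs_map, sm_add_large] at e
  let s1 : lam.1.parts.ToType →₀ ℕ := Finsupp.equivFunOnFinite.symm
    (fun i => if fs lam.1.parts i < p ^ r then fs lam.1.parts i else 0)
  let s2 : lam.1.parts.ToType →₀ ℕ := Finsupp.equivFunOnFinite.symm
    (fun i => if p ^ r ≤ fs lam.1.parts i then fs lam.1.parts i else 0)
  have hs1 : ∀ i, s1 i = if fs lam.1.parts i < p ^ r then fs lam.1.parts i else 0 := fun i => rfl
  have hs2 : ∀ i, s2 i = if p ^ r ≤ fs lam.1.parts i then fs lam.1.parts i else 0 := fun i => rfl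
  have hf1 : (Finset.univ.val.map s1).filter (fun x => x ≠ 0) = sm p r lam.1.parts := by
    unfold sm
    conv_rhs => rw [← fs_map lam.1.parts]
    rw [Multiset.filter_map, Multiset.filter_map]
    have : Multiset.filter ((fun x => x ≠ 0) ∘ s1) Finset.univ.val
        = Multiset.filter ((fun j => j < p ^ r) ∘ (fs lam.1.parts)) Finset.univ.val := by
      refine Multiset.filter_congr fun i _ => ?_
      have := hpos i
      simp only [Function.comp, hs1]
      split_ifs with hlt
      · simp only [hlt, iff_true]; omega
      · simp [hlt]
    rw [this]
    refine Multiset.map_congr rfl fun i hi => ?_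
    rw [hs1]
    exact if_pos (Multiset.mem_filter.1 hi).2
  have hf2 : (Finset.univ.val.map s2).filter (fun x => x ≠ 0)
      = lam.1.parts.filter (fun j => p ^ r ≤ j) := by
    conv_rhs => rw [← fs_map lam.1.parts]
    rw [Multiset.filter_map, Multiset.filter_map]
    have : Multiset.filter ((fun x => x ≠ 0) ∘ s2) Finset.univ.val
        = Multiset.filter ((fun j => p ^ r ≤ j) ∘ (fs lam.1.parts)) Finset.univ.val := by
      refine Multiset.filter_congr fun i _ => ?_
      have := hpos i
      simp only [Function.comp, hs2]
      split_ifs with hlt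
      · simp only [hlt, iff_true]; omega
      · simp [hlt]
    rw [this]
    refine Multiset.map_congr rfl fun i hi => ?_
    rw [hs2]
    exact if_pos (Multiset.mem_filter.1 hi).2
  have hPsm : PB p (sm p r mu.1.parts) := fun j hj => mu.2 j (Multiset.mem_filter.1 hj).1
  have hPl : PB p (mu.1.parts.filter (fun j => p ^ r ≤ j)) :=
    fun j hj => mu.2 j (Multiset.mem_filter.1 hj).1
  rw [e, Finset.sum_eq_single (s1, s2)]
  · rw [Mcount_filter p hp _ _ hPsm, Mcount_filter p hp _ _ hPl, hf1, hf2, ← h,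
      Mcount_self (sm p r lam.1.parts) (fun x hx => lam.1.parts_pos (Multiset.mem_filter.1 hx).1),
      ← lamGeq_mul p hp r _ mu.2, ← lamGeq_mul p hp r _ lam.2]
    congr 1
    have h3 := Mcount_scale (p ^ r) (pow_pos hp.pos r) (fam (lamGeq p r lam.1.parts))
      (lamGeq p r mu.1.parts)
    have h4 : Finset.univ.val.map (fun i => p ^ r * fam (lamGeq p r lam.1.parts) i)
        = (lamGeq p r lam.1.parts).map (fun x => p ^ r * x) := by
      conv_rhs => rw [← fam_map (lamGeq p r lam.1.parts), Multiset.map_map]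
      rfl
    rw [fam_map, h4] at h3
    exact h3
  · rintro ⟨t1, t2⟩ ht hne
    by_contra hcon
    rw [mul_eq_zero, not_or] at hcon
    obtain ⟨hc1, hc2⟩ := hcon
    apply hne
    rw [← lamGeq_mul p hp r _ mu.2] at hc2
    have hg := Mcount_scale_dvd _ _ _ hc2
    have hAD : (t1, t2) ∈ AD p r lam.1.parts := by
      unfold AD
      exact Finset.mem_filter.2 ⟨ht, hg⟩
    have hsum := Mcount_sum hc1
    rw [← h, ← hf1] at hsum
    have hsum1 : ((Finset.univ.val.map s1).filter (fun x => x ≠ 0)).sum = ∑ i, s1 i := by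
      have h4 := congrArg Multiset.sum
        (Multiset.filter_add_not (fun x => x ≠ 0) (Finset.univ.val.map s1))
      rw [Multiset.sum_add] at h4
      have h5 : ((Finset.univ.val.map s1).filter (fun x => ¬ x ≠ 0)).sum = 0 :=
        Multiset.sum_eq_zero fun x hx => not_not.1 (Multiset.mem_filter.1 hx).2
      rw [h5, add_zero] at h4
      exact h4
    rw [hsum1] at hsum
    change ∑ i, t1 i = ∑ i, s1 i at hsum
    have hle : ∀ i ∈ Finset.univ, s1 i ≤ t1 i := by
      intro i _
      rw [hs1]
      split_ifs with hlt
      · exact (AD_spec p r _ _ hAD i hlt).2.ge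
      · exact Nat.zero_le _
    have heq := (Finset.sum_eq_sum_iff_of_le hle).1 hsum.symm
    rw [Finset.HasAntidiagonal.mem_antidiagonal] at ht
    have ht' : ∀ i, t1 i + t2 i = fs lam.1.parts i := fun i => by rw [← ht]; rfl
    refine Prod.ext ?_ ?_
    · ext i
      exact (heq i (Finset.mem_univ _)).symm
    · ext i
      have h1 := heq i (Finset.mem_univ _)
      have h2 := ht' i
      rw [hs1] at h1
      change t2 i = s2 i
      rw [hs2]
      split_ifs at h1 ⊢ <;> omega
  · intro hnot
    exfalso
    apply hnot
    rw [Finset.HasAntidiagonal.mem_antidiagonal]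
    ext i
    change s1 i + s2 i = _
    rw [hs1, hs2]
    split_ifs <;> omega

/-- The coefficient vectors supplied by `D_lemma`. -/
def Dco (p : ℕ) (hp : p.Prime) (r w : ℕ) (A : Multiset ℕ) : PowP p w → ℚ :=
  Classical.choose (D_lemma p hp r w A)

theorem Dco_mem (p : ℕ) (hp : p.Prime) (r w : ℕ) (A : Multiset ℕ) (nu : PowP p w) :
    Dco p hp r w A nu ∈ Zploc p hp := (Classical.choose_spec (D_lemma p hp r w A)).1 nu

theorem Dco_spec (p : ℕ) (hp : p.Prime) (r w : ℕ) (A : Multiset ℕ) (mu : PowP p w) :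
    (Mcount A (lamGeq p r mu.1.parts) : ℚ) = ∑ nu, Dco p hp r w A nu * Cmat p r w nu mu :=
  (Classical.choose_spec (D_lemma p hp r w A)).2 mu

/-- The matrix `N C⁻¹`. -/
def Wm (p : ℕ) (hp : p.Prime) (r w : ℕ) : Matrix (PowP p w) (PowP p w) ℚ :=
  Matrix.of fun lam mu => ∑ s ∈ AD p r lam.1.parts,
    (Mcount (Finset.univ.val.map s.1) (sm p r mu.1.parts) : ℚ) *
      Dco p hp r w (Finset.univ.val.map (fun i => s.2 i / p ^ r)) mu

theorem Wm_apply (p : ℕ) (hp : p.Prime) (r w : ℕ) (lam mu : PowP p w) :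
    Wm p hp r w lam mu = ∑ s ∈ AD p r lam.1.parts,
    (Mcount (Finset.univ.val.map s.1) (sm p r mu.1.parts) : ℚ) *
      Dco p hp r w (Finset.univ.val.map (fun i => s.2 i / p ^ r)) mu := rfl

theorem N_eq (p : ℕ) (hp : p.Prime) (r w : ℕ) : Nmat p w = Wm p hp r w * Cmat p r w := by
  ext lam mu
  change (Mcount lam.1.parts mu.1.parts : ℚ) = _
  rw [Matrix.mul_apply, N_expand p hp r w lam mu]
  push_cast
  simp only [Wm_apply, Dco_spec p hp r w _ mu, Finset.mul_sum, Finset.sum_mul]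
  rw [Finset.sum_comm]
  refine Finset.sum_congr rfl fun nu _ => Finset.sum_congr rfl fun s _ => ?_
  rw [← mul_assoc]
  by_cases hb : lamBar p r nu.1.parts = lamBar p r mu.1.parts
  · rw [(lamBar_iff p r w nu mu).1 hb]
  · rw [Cmat_apply, if_neg hb, mul_zero, mul_zero]

theorem U_eq (p : ℕ) (hp : p.Prime) (r w : ℕ) (lam mu : PowP p w) :
    ((xLess p r w)⁻¹ * Nmat p w * (Cmat p r w)⁻¹) lam mu
      = ((xprod (sm p r lam.1.parts) : ℕ) : ℚ)⁻¹ * Wm p hp r w lam mu := by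
  rw [N_eq p hp, Matrix.mul_assoc, Matrix.mul_nonsing_inv_cancel_right _ _ (Cmat_isUnit p hp r w)]
  have hx : (xLess p r w)⁻¹ = Matrix.diagonal
      (fun lam : PowP p w => ((xprod (sm p r lam.1.parts) : ℕ) : ℚ)⁻¹) := by
    apply Matrix.inv_eq_right_inv
    unfold xLess
    rw [Matrix.diagonal_mul_diagonal, ← Matrix.diagonal_one]
    congr 1
    funext l
    rw [xprod_sm p hp r _ l.2, mul_inv_cancel₀]
    exact_mod_cast (xprod_pos _).ne'
  rw [hx, Matrix.diagonal_mul]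

theorem W_diag (p : ℕ) (hp : p.Prime) (r w : ℕ) (lam mu : PowP p w)
    (h : lamBar p r lam.1.parts = lamBar p r mu.1.parts) :
    Wm p hp r w lam mu = if lam = mu then ((xprod (sm p r lam.1.parts) : ℕ) : ℚ) else 0 := by
  let y : PowP p w → ℚ := fun nu =>
    if lamBar p r lam.1.parts = lamBar p r nu.1.parts then Wm p hp r w lam nu else 0
  let z : PowP p w → ℚ := fun nu =>
    if lam = nu then ((xprod (sm p r lam.1.parts) : ℕ) : ℚ) else 0
  have hyz : Matrix.vecMul y (Cmat p r w) = Matrix.vecMul z (Cmat p r w) := by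
    funext nu
    have hz : Matrix.vecMul z (Cmat p r w) nu
        = ((xprod (sm p r lam.1.parts) : ℕ) : ℚ) * Cmat p r w lam nu := by
      simp [Matrix.vecMul, dotProduct, z]
    rw [hz]
    change ∑ k, y k * Cmat p r w k nu = _
    by_cases hb : lamBar p r lam.1.parts = lamBar p r nu.1.parts
    · have h1 : ∑ k, y k * Cmat p r w k nu = ∑ k, Wm p hp r w lam k * Cmat p r w k nu := by
        refine Finset.sum_congr rfl fun k _ => ?_
        by_cases hk : lamBar p r k.1.parts = lamBar p r nu.1.parts
        · simp only [y]
          rw [if_pos (hb.trans hk.symm)]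
        · rw [Cmat_apply, if_neg hk, mul_zero, mul_zero]
      rw [h1, ← Matrix.mul_apply, ← N_eq, Cmat_apply, if_pos hb]
      change (Mcount lam.1.parts nu.1.parts : ℚ) = _
      rw [N_diag p hp r w lam nu ((lamBar_iff p r w lam nu).1 hb)]
      push_cast
      rfl
    · rw [Cmat_apply, if_neg hb, mul_zero]
      refine Finset.sum_eq_zero fun k _ => ?_
      by_cases hk : lamBar p r k.1.parts = lamBar p r nu.1.parts
      · simp only [y]
        rw [if_neg (fun hl => hb (hl.trans hk)), zero_mul]
      · rw [Cmat_apply, if_neg hk, mul_zero]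
  have hyz' : y = z := by
    have h1 := congrArg (fun v => Matrix.vecMul v (Cmat p r w)⁻¹) hyz
    simp only [Matrix.vecMul_vecMul, Matrix.mul_nonsing_inv _ (Cmat_isUnit p hp r w),
      Matrix.vecMul_one] at h1
    exact h1
  have := congrFun hyz' mu
  simp only [y, z] at this
  rw [if_pos h] at this
  exact this

theorem sm_dvd (p : ℕ) (r w : ℕ) (lam : PowP p w)
    (s : (lam.1.parts.ToType →₀ ℕ) × (lam.1.parts.ToType →₀ ℕ)) (hs : s ∈ AD p r lam.1.parts)
    (B : Multiset ℕ) : xprod (sm p r lam.1.parts) ∣ Mcount (Finset.univ.val.map s.1) B := by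
  have h1 := Multiset.filter_add_not (fun i => fs lam.1.parts i < p ^ r)
    (Finset.univ.val : Multiset lam.1.parts.ToType)
  have h2 : (Multiset.filter (fun i => fs lam.1.parts i < p ^ r)
      (Finset.univ.val : Multiset lam.1.parts.ToType)).map s.1 = sm p r lam.1.parts := by
    unfold sm
    conv_rhs => rw [← fs_map lam.1.parts]
    rw [Multiset.filter_map]
    refine Multiset.map_congr rfl fun i hi => ?_
    exact (AD_spec p r _ s hs i (Multiset.mem_filter.1 hi).2).2
  rw [← h1, Multiset.map_add, h2]
  exact xprod_dvd_Mcount_add _ _ _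
    (fun x hx => lam.1.parts_pos (Multiset.mem_filter.1 hx).1)

theorem U_mem (p : ℕ) (hp : p.Prime) (r w : ℕ) (lam mu : PowP p w) :
    ((xprod (sm p r lam.1.parts) : ℕ) : ℚ)⁻¹ * Wm p hp r w lam mu ∈ Zploc p hp := by
  rw [Wm_apply, Finset.mul_sum]
  refine Subring.sum_mem _ fun s hs => ?_
  obtain ⟨q, hq⟩ := sm_dvd p r w lam s hs (sm p r mu.1.parts)
  have hx : ((xprod (sm p r lam.1.parts) : ℕ) : ℚ) ≠ 0 := by exact_mod_cast (xprod_pos _).ne'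
  rw [hq, Nat.cast_mul, ← mul_assoc, ← mul_assoc, inv_mul_cancel₀ hx, one_mul]
  exact Subring.mul_mem _ (natCast_mem _ q) (Dco_mem p hp r w _ _)

theorem U_val (p : ℕ) (hp : p.Prime) (r w : ℕ) (lam mu : PowP p w)
    (h : lamBar p r lam.1.parts ≠ lamBar p r mu.1.parts)
    (h0 : ((xprod (sm p r lam.1.parts) : ℕ) : ℚ)⁻¹ * Wm p hp r w lam mu ≠ 0) :
    kVal p r lam.1.parts - kVal p r mu.1.parts
      < padicValRat p (((xprod (sm p r lam.1.parts) : ℕ) : ℚ)⁻¹ * Wm p hp r w lam mu) := by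
  have := Fact.mk hp
  have hne : sm p r lam.1.parts ≠ sm p r mu.1.parts := fun he => h ((lamBar_iff p r w _ _).2 he)
  obtain ⟨hx0, hW0⟩ := mul_ne_zero_iff.1 h0
  set K := padicValNat p (xprod (sm p r mu.1.parts)) + ∑ i, gv p r (fs lam.1.parts i) + 1
    - ((sm p r mu.1.parts).map (gv p r)).sum with hK
  have hd : ∀ s ∈ AD p r lam.1.parts,
      p ^ K ∣ Mcount (Finset.univ.val.map s.1) (sm p r mu.1.parts) := by
    intro s hs
    refine count_val p hp r (fs lam.1.parts) s.1 (sm p r mu.1.parts)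
      (fun i => lam.2 _ (fs_mem _ i)) ?_ (fun i hi => (AD_spec p r _ s hs i hi).2)
      (by rw [fs_map]; exact hne)
    intro x hx
    rw [sm, Multiset.mem_filter] at hx
    obtain ⟨n, rfl⟩ := mu.2 x hx.1
    exact ⟨n, (Nat.pow_lt_pow_iff_right hp.one_lt).1 hx.2, rfl⟩
  have hp0 : (p : ℚ) ≠ 0 := by exact_mod_cast hp.ne_zero
  have hW : ∃ q ∈ Zploc p hp, Wm p hp r w lam mu = (p : ℚ) ^ K * q := by
    refine ⟨∑ s ∈ AD p r lam.1.parts,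
      ((Mcount (Finset.univ.val.map s.1) (sm p r mu.1.parts) / p ^ K : ℕ) : ℚ) *
      Dco p hp r w (Finset.univ.val.map (fun i => s.2 i / p ^ r)) mu, ?_, ?_⟩
    · exact Subring.sum_mem _ fun s _ => Subring.mul_mem _ (natCast_mem _ _) (Dco_mem p hp r w _ _)
    · rw [Wm_apply, Finset.mul_sum]
      refine Finset.sum_congr rfl fun s hs => ?_
      rw [← mul_assoc, ← Nat.cast_pow, ← Nat.cast_mul, Nat.mul_div_cancel' (hd s hs)]
  obtain ⟨q, hq, hWq⟩ := hW
  have hq0 : q ≠ 0 := by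
    rintro rfl
    exact hW0 (by rw [hWq, mul_zero])
  have hv := padicValRat_nonneg_of_mem p hp q hq
  rw [padicValRat.mul hx0 hW0, padicValRat.inv, padicValRat.of_nat, hWq,
    padicValRat.mul (pow_ne_zero _ hp0) hq0, padicValRat.pow, padicValRat.self hp.one_lt]
  have hg : ∑ i, gv p r (fs lam.1.parts i) = fVal p r lam.1.parts := by
    rw [← gv_sum p hp r _ lam.2]
    conv_rhs => rw [← fs_map lam.1.parts, Multiset.map_map]
    rfl
  rw [hg, ← eVal_eq p hp r _ mu.2, ← fVal_eq p hp r _ mu.2] at hK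
  rw [← eVal_eq p hp r _ lam.2]
  unfold kVal
  omega

theorem U_final (p : ℕ) (hp : p.Prime) (r w : ℕ) (lam mu : PowP p w) :
    ((xLess p r w)⁻¹ * Nmat p w * (Cmat p r w)⁻¹) lam mu ∈ Zploc p hp
    ∧ (lamBar p r lam.1.parts = lamBar p r mu.1.parts →
        ((xLess p r w)⁻¹ * Nmat p w * (Cmat p r w)⁻¹) lam mu
          = if lam = mu then 1 else 0)
    ∧ (lamBar p r lam.1.parts ≠ lamBar p r mu.1.parts →
        (((xLess p r w)⁻¹ * Nmat p w * (Cmat p r w)⁻¹) lam mu = 0 ∨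
          kVal p r lam.1.parts - kVal p r mu.1.parts
            < padicValRat p (((xLess p r w)⁻¹ * Nmat p w * (Cmat p r w)⁻¹) lam mu))) := by
  rw [U_eq p hp r w lam mu]
  refine ⟨U_mem p hp r w lam mu, fun h => ?_, fun h => ?_⟩
  · rw [W_diag p hp r w lam mu h]
    split_ifs
    · rw [inv_mul_cancel₀]
      exact_mod_cast (xprod_pos _).ne'
    · rw [mul_zero]
  · by_cases h0 : ((xprod (sm p r lam.1.parts) : ℕ) : ℚ)⁻¹ * Wm p hp r w lam mu = 0
    · exact Or.inl h0
    · exact Or.inr (U_val p hp r w lam mu h h0)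

/-- **Lemma 5.2.** Let `U = (x^{<r})⁻¹ N C⁻¹`. For all `λ, μ ∈ Pow(w)`:
(i) `U_{λμ} ∈ ℤ_(p)`; (ii) `U_{λμ} = δ_{λμ}` whenever `λ̄ = μ̄`;
(iii) `v_p(U_{λμ}) > k_λ - k_μ` whenever `λ̄ ≠ μ̄`. -/
theorem U_entries (p : ℕ) (hp : p.Prime) (r w : ℕ) (lam mu : PowP p w) :
    ((xLess p r w)⁻¹ * Nmat p w * (Cmat p r w)⁻¹) lam mu ∈ Zploc p hp
    ∧ (lamBar p r lam.1.parts = lamBar p r mu.1.parts →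
        ((xLess p r w)⁻¹ * Nmat p w * (Cmat p r w)⁻¹) lam mu
          = if lam = mu then 1 else 0)
    ∧ (lamBar p r lam.1.parts ≠ lamBar p r mu.1.parts →
        (((xLess p r w)⁻¹ * Nmat p w * (Cmat p r w)⁻¹) lam mu = 0 ∨
          kVal p r lam.1.parts - kVal p r mu.1.parts
            < padicValRat p (((xLess p r w)⁻¹ * Nmat p w * (Cmat p r w)⁻¹) lam mu))) := by
  exact U_final p hp r w lam mu

end
end
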